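/- For every k₀ > 0 there exists h₀ > 0 such that whenever k ≥ k₀, h ∈ (0,h₀] and τ : W → [0,h] is locally Lipschitz, the dynamical system (S_t, W) defined by S_t φ = u_t (where u is the unique global mild solution with initial datum φ) possesses a compact global attractor: there exists a compact set 𝔄 ⊆ W such that (i) S_t 𝔄 = 𝔄 for every t ≥ 0 (i.e., for every ψ ∈ 𝔄 and t ≥ 0 one has S_t ψ ∈ 𝔄, and there exists χ ∈ 𝔄 with S_t χ = ψ), and (ii) 𝔄 uniformly attracts bounded sets: for every bounded set B ⊆ W and every ε > 0 there exists T ≥ 0 such that for all φ ∈ B and all t ≥ T one has inf_{ψ∈𝔄} |S_t φ − ψ|_W ≤ ε. -/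

import Mathlib

open Set Real MeasureTheory
open scoped RealInnerProductSpace

noncomputable section

/-- Euclidean space `ℝⁿ`. -/
abbrev Euc (n : ℕ) := EuclideanSpace ℝ (Fin n)

/-- `(φ, φ')` is a `C¹` pair on `[-h,0]`: `φ'` is the (one-sided) derivative of `φ` on
`[-h,0]` and is continuous there. -/
def IsC1Pair (n : ℕ) (h : ℝ) (φ φ' : ℝ → Euc n) : Prop :=
  (∀ θ ∈ Icc (-h) (0:ℝ), HasDerivWithinAt φ (φ' θ) (Icc (-h) 0) θ) ∧
    ContinuousOn φ' (Icc (-h) 0)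

/-- The norm of `W = C¹([-h,0];ℝⁿ)`:
`|φ|_W = max_{θ∈[-h,0]} ‖φ(θ)‖ + max_{θ∈[-h,0]} ‖φ'(θ)‖`. -/
def Wnorm (n : ℕ) (h : ℝ) (φ φ' : ℝ → Euc n) : ℝ :=
  (⨆ θ : Icc (-h) (0:ℝ), ‖φ θ.1‖) + ⨆ θ : Icc (-h) (0:ℝ), ‖φ' θ.1‖

/-- A mild solution of `ü + k u̇ + A u + F(u) + M(u_t) = 0` on `[0,T)` with initial
datum `(φ, φ')`: `u` is `C¹` on `[-h,T)` with derivative `u'`, coincides with `φ` on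
`[-h,0]`, and `u̇(t) = φ'(0) - ∫₀ᵗ (k u̇(s) + A u(s) + F(u(s)) + M(u_s)) ds` on `[0,T)`.
Here `M` takes the segment `u_s` as a pair (the function and its derivative). -/
def IsMildSolOn (n : ℕ) (h k T : ℝ) (A : Euc n →L[ℝ] Euc n) (F : Euc n → Euc n)
    (M : (ℝ → Euc n) → (ℝ → Euc n) → Euc n) (φ φ' u u' : ℝ → Euc n) : Prop :=
  (∀ t ∈ Ico (-h) T, HasDerivWithinAt u (u' t) (Ico (-h) T) t) ∧
  ContinuousOn u' (Ico (-h) T) ∧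
  (∀ θ ∈ Icc (-h) (0:ℝ), u θ = φ θ ∧ u' θ = φ' θ) ∧
  (∀ t ∈ Ico (0:ℝ) T, u' t = φ' 0 - ∫ s in (0:ℝ)..t,
      (k • u' s + A (u s) + F (u s) + M (fun θ => u (s + θ)) (fun θ => u' (s + θ))))

/-- A global mild solution (on `[0,∞)`). -/
def IsGlobalMildSol (n : ℕ) (h k : ℝ) (A : Euc n →L[ℝ] Euc n) (F : Euc n → Euc n)
    (M : (ℝ → Euc n) → (ℝ → Euc n) → Euc n) (φ φ' u u' : ℝ → Euc n) : Prop :=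
  (∀ t ∈ Ici (-h), HasDerivWithinAt u (u' t) (Ici (-h)) t) ∧
  ContinuousOn u' (Ici (-h)) ∧
  (∀ θ ∈ Icc (-h) (0:ℝ), u θ = φ θ ∧ u' θ = φ' θ) ∧
  (∀ t ∈ Ici (0:ℝ), u' t = φ' 0 - ∫ s in (0:ℝ)..t,
      (k • u' s + A (u s) + F (u s) + M (fun θ => u (s + θ)) (fun θ => u' (s + θ))))

/-- Hypothesis (M1): local Lipschitz property of the delay term in the `W`-norm. -/
def HypM1 (n : ℕ) (h : ℝ) (M : (ℝ → Euc n) → (ℝ → Euc n) → Euc n) : Prop :=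
  ∀ ρ > (0:ℝ), ∃ C > (0:ℝ), ∀ φ₁ φ₁' φ₂ φ₂' : ℝ → Euc n,
    IsC1Pair n h φ₁ φ₁' → IsC1Pair n h φ₂ φ₂' →
    Wnorm n h φ₁ φ₁' ≤ ρ → Wnorm n h φ₂ φ₂' ≤ ρ →
    ‖M φ₁ φ₁' - M φ₂ φ₂'‖ ≤ C * Wnorm n h (φ₁ - φ₂) (φ₁' - φ₂')

/-- The space in which we realize `W = C¹([-h,0];ℝⁿ)`: pairs of continuous maps
(the function and its derivative) on `[-h,0]`, with the product (sup) topology. -/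
abbrev Wc (n : ℕ) (h : ℝ) := C(Icc (-h) (0:ℝ), Euc n) × C(Icc (-h) (0:ℝ), Euc n)

/-- Extension of a continuous map on `[-h,0]` to `ℝ` (by junk value `0` outside;
only the values on `[-h,0]` and at `0` are ever used). -/
def extIcc (n : ℕ) (h : ℝ) (f : C(Icc (-h) (0:ℝ), Euc n)) : ℝ → Euc n :=
  fun x => if hx : x ∈ Icc (-h) (0:ℝ) then f ⟨x, hx⟩ else 0

/-- Membership in `W`: the second component is the derivative of the first. -/
def InW (n : ℕ) (h : ℝ) (p : Wc n h) : Prop :=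
  IsC1Pair n h (extIcc n h p.1) (extIcc n h p.2)

/-- `p` is the segment `(u_t, u̇_t)` of the solution `(u, u')` at time `t`. -/
def IsSegAt (n : ℕ) (h : ℝ) (u u' : ℝ → Euc n) (t : ℝ) (p : Wc n h) : Prop :=
  ∀ θ : Icc (-h) (0:ℝ), p.1 θ = u (t + θ.1) ∧ p.2 θ = u' (t + θ.1)

/-- The `W`-distance between the segment of a solution at time `t` and `q ∈ W`. -/
def segWdist (n : ℕ) (h : ℝ) (u u' : ℝ → Euc n) (t : ℝ) (q : Wc n h) : ℝ :=
  (⨆ θ : Icc (-h) (0:ℝ), ‖u (t + θ.1) - q.1 θ‖) + ⨆ θ : Icc (-h) (0:ℝ), ‖u' (t + θ.1) - q.2 θ‖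

open Filter Topology

/-! ### Curves and trajectories of autonomous delay fields -/

/-- `u` is a `C¹` curve on `ℝ` with derivative `v`. -/
def IsC1Curve {E : Type*} [NormedAddCommGroup E] [NormedSpace ℝ E] (u v : ℝ → E) : Prop :=
  (∀ t, HasDerivAt u (v t) t) ∧ Continuous v

/-- An autonomous second order right-hand side with memory `h`, Lipschitz on bounded sets of
`C¹` histories. -/
structure IsDelayField {E : Type*} [NormedAddCommGroup E] [NormedSpace ℝ E] (h : ℝ)
    (N : (ℝ → E) → (ℝ → E) → ℝ → E) : Prop where
  shift : ∀ u v c s, N (fun t => u (t + c)) (fun t => v (t + c)) s = N u v (s + c)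
  lipschitz : ∀ R > 0, ∃ Λ, 0 ≤ Λ ∧ ∀ u₁ v₁ u₂ v₂ s m, IsC1Curve u₁ v₁ → IsC1Curve u₂ v₂ →
    (∀ r ∈ Icc (s - h) s, ‖u₁ r‖ ≤ R ∧ ‖v₁ r‖ ≤ R ∧ ‖u₂ r‖ ≤ R ∧ ‖v₂ r‖ ≤ R) →
    (∀ r ∈ Icc (s - h) s, ‖u₁ r - u₂ r‖ ≤ m ∧ ‖v₁ r - v₂ r‖ ≤ m) →
    ‖N u₁ v₁ s - N u₂ v₂ s‖ ≤ Λ * m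

/-- A `C¹` curve which solves `u'' = -N(u)` on `[a,∞)` in integrated form. -/
def IsTraj {E : Type*} [NormedAddCommGroup E] [NormedSpace ℝ E]
    (N : (ℝ → E) → (ℝ → E) → ℝ → E) (a : ℝ) (u v : ℝ → E) : Prop :=
  IsC1Curve u v ∧ ∀ s t, a ≤ s → s ≤ t → v t = v s - ∫ r in s..t, N u v r

/-- Along an ultrafilter, a uniformly Lipschitz family of curves which is bounded at `0`
converges locally uniformly. -/
lemma exists_tendstoLocallyUniformly_of_lipschitz {E : Type*}
    [NormedAddCommGroup E] [ProperSpace E] {ι : Type*}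
    (𝒰 : Ultrafilter ι) (f : ι → ℝ → E) (L : ℝ) (hL : 0 ≤ L)
    (hLip : ∀ᶠ i in (𝒰 : Filter ι), ∀ s t, ‖f i t - f i s‖ ≤ L * |t - s|)
    (hb : ∀ᶠ i in (𝒰 : Filter ι), ‖f i 0‖ ≤ L) :
    ∃ g : ℝ → E, Continuous g ∧ TendstoLocallyUniformly f g (𝒰 : Filter ι) := by
  have hpt : ∀ t, ∃ y, Tendsto (fun i => f i t) 𝒰 (𝓝 y) := by
    intro t
    obtain ⟨y, -, hy⟩ := (isCompact_closedBall (0 : E) (L + L * |t|)).ultrafilter_le_nhds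
      (𝒰.map fun i => f i t) (by
        rw [Ultrafilter.coe_map, le_principal_iff, mem_map]
        filter_upwards [hLip, hb] with i h1 h2
        have := h1 0 t
        rw [sub_zero] at this
        simp only [mem_preimage, mem_closedBall_zero_iff]
        calc ‖f i t‖ = ‖f i 0 + (f i t - f i 0)‖ := by simp
          _ ≤ _ := (norm_add_le _ _).trans (by gcongr))
    exact ⟨y, hy⟩
  choose g hg using hpt
  have hgL : ∀ s t, ‖g t - g s‖ ≤ L * |t - s| := fun s t =>
    le_of_tendsto ((hg t).sub (hg s)).norm (by filter_upwards [hLip] with i hi using hi s t)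
  refine ⟨g, ?_, ?_⟩
  · have : LipschitzWith ⟨L, hL⟩ g := LipschitzWith.of_dist_le_mul fun x y => by
      rw [dist_eq_norm, Real.dist_eq]
      exact hgL y x
    exact this.continuous
  · rw [Metric.tendstoLocallyUniformly_iff]
    intro ε hε x
    refine ⟨Metric.ball x (ε / (4 * (L + 1))), Metric.ball_mem_nhds _ (by positivity), ?_⟩
    have h3 : ∀ᶠ i in (𝒰 : Filter ι), dist (f i x) (g x) < ε / 4 :=
      (hg x) (Metric.ball_mem_nhds _ (by positivity))
    filter_upwards [hLip, h3] with i h1 h3 y hy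
    rw [Metric.mem_ball, Real.dist_eq, lt_div_iff₀ (by positivity)] at hy
    have e1 := h1 y x
    have e2 := hgL x y
    rw [abs_sub_comm] at e1
    have e3 : L * |y - x| ≤ ε / 4 := by nlinarith [abs_nonneg (y - x)]
    rw [dist_eq_norm] at h3 ⊢
    calc ‖g y - f i y‖ = ‖(g y - g x) - (f i x - g x) + (f i x - f i y)‖ := by congr 1; abel
      _ ≤ ‖g y - g x‖ + ‖f i x - g x‖ + ‖f i x - f i y‖ :=
        (norm_add_le _ _).trans (by gcongr; exact norm_sub_le _ _)
      _ < ε := by linarith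

lemma TendstoLocallyUniformly.eventually_norm_sub_le_Icc {E : Type*}
    [NormedAddCommGroup E] {ι : Type*} {l : Filter ι} {f : ι → ℝ → E} {g : ℝ → E}
    (hf : TendstoLocallyUniformly f g l) (a b : ℝ) {ε : ℝ}
    (hε : 0 < ε) : ∀ᶠ i in l, ∀ t ∈ Icc a b, ‖f i t - g t‖ ≤ ε := by
  have := (tendstoLocallyUniformly_iff_forall_isCompact.1 hf) (Icc a b) isCompact_Icc
  rw [Metric.tendstoUniformlyOn_iff] at this
  filter_upwards [this ε hε] with i hi t ht
  rw [← dist_eq_norm, dist_comm]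
  exact (hi t ht).le

section Abstract

variable {E : Type*} [NormedAddCommGroup E] [NormedSpace ℝ E]
  {N : (ℝ → E) → (ℝ → E) → ℝ → E} {h : ℝ} {u v : ℝ → E}

lemma IsC1Curve.continuous (hu : IsC1Curve u v) : Continuous u :=
  continuous_iff_continuousAt.2 fun t => (hu.1 t).continuousAt

lemma IsC1Curve.shift (hu : IsC1Curve u v) (c : ℝ) :
    IsC1Curve (fun t => u (t + c)) (fun t => v (t + c)) :=
  ⟨fun t => (hu.1 (t + c)).comp_add_const t c, hu.2.comp (by fun_prop)⟩

lemma isC1Curve_zero : IsC1Curve (fun _ : ℝ => (0 : E)) (fun _ => 0) :=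
  ⟨fun t => hasDerivAt_const t 0, continuous_const⟩

lemma IsC1Curve.exists_bound (hu : IsC1Curve u v) (a b : ℝ) :
    ∃ R > 0, ∀ t ∈ Icc a b, ‖u t‖ ≤ R ∧ ‖v t‖ ≤ R := by
  obtain ⟨R₁, h₁⟩ := (isCompact_Icc (a := a) (b := b)).exists_bound_of_continuousOn
    hu.continuous.continuousOn
  obtain ⟨R₂, h₂⟩ := (isCompact_Icc (a := a) (b := b)).exists_bound_of_continuousOn
    hu.2.continuousOn
  refine ⟨max 1 (max R₁ R₂), by positivity, fun t ht => ⟨?_, ?_⟩⟩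
  · exact (h₁ t ht).trans (by simp)
  · exact (h₂ t ht).trans (by simp)

lemma IsC1Curve.sub_eq_integral [CompleteSpace E] (hu : IsC1Curve u v) (s t : ℝ) :
    u t - u s = ∫ r in s..t, v r :=
  (intervalIntegral.integral_eq_sub_of_hasDerivAt (fun r _ => hu.1 r)
    (hu.2.intervalIntegrable _ _)).symm

lemma IsC1Curve.norm_sub_le [CompleteSpace E] (hu : IsC1Curve u v) {R s t : ℝ}
    (hR : ∀ r ∈ uIcc s t, ‖v r‖ ≤ R) : ‖u t - u s‖ ≤ R * |t - s| := by
  rw [hu.sub_eq_integral]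
  exact intervalIntegral.norm_integral_le_of_norm_le_const
    fun r hr => hR r (uIoc_subset_uIcc hr)

/-- A `C¹` function on `[a,∞)` extends to a `C¹` curve on `ℝ`, with derivative constant
before `a`. -/
lemma exists_isC1Curve_extension [CompleteSpace E] {a : ℝ}
    (hd : ∀ t ∈ Ici a, HasDerivWithinAt u (v t) (Ici a) t) (hv : ContinuousOn v (Ici a)) :
    ∃ u₁, IsC1Curve u₁ (fun t => v (max a t)) ∧ ∀ t, a ≤ t → u₁ t = u t := by
  have hc : Continuous fun t => v (max a t) :=
    hv.comp_continuous (by fun_prop) fun t => mem_Ici.2 (le_max_left _ _)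
  refine ⟨fun t => u a + ∫ s in a..t, v (max a s), ⟨fun t => ?_, hc⟩, fun t ht => ?_⟩
  · exact (intervalIntegral.integral_hasDerivAt_right (hc.intervalIntegrable _ _)
      (hc.stronglyMeasurableAtFilter _ _) hc.continuousAt).const_add _
  · have : ∫ s in a..t, v (max a s) = u t - u a := by
      refine intervalIntegral.integral_eq_sub_of_hasDeriv_right ?_ ?_ (hc.intervalIntegrable _ _)
      · rw [uIcc_of_le ht]
        exact fun x hx => ((hd x hx.1).continuousWithinAt).mono Icc_subset_Ici_self
      · intro x hx
        rw [min_eq_left ht] at hx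
        rw [max_eq_right hx.1.le]
        exact (hd x hx.1.le).mono fun y hy => hx.1.le.trans (le_of_lt hy)
    simp [this]

lemma IsDelayField.congr (hN : IsDelayField h N) {u₁ v₁ u₂ v₂ : ℝ → E} (h₁ : IsC1Curve u₁ v₁)
    (h₂ : IsC1Curve u₂ v₂) {s : ℝ} (heq : ∀ r ∈ Icc (s - h) s, u₁ r = u₂ r ∧ v₁ r = v₂ r) :
    N u₁ v₁ s = N u₂ v₂ s := by
  obtain ⟨R, hR, hb⟩ := h₁.exists_bound (s - h) s
  obtain ⟨Λ, -, hΛ⟩ := hN.lipschitz R hR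
  have := hΛ u₁ v₁ u₂ v₂ s 0 h₁ h₂
    (fun r hr => ⟨(hb r hr).1, (hb r hr).2, (heq r hr).1 ▸ (hb r hr).1, (heq r hr).2 ▸ (hb r hr).2⟩)
    (fun r hr => by simp [heq r hr])
  rw [mul_zero] at this
  exact sub_eq_zero.1 (norm_le_zero_iff.1 this)

lemma IsDelayField.exists_bound (hN : IsDelayField h N) (R : ℝ) :
    ∃ K, 0 ≤ K ∧ ∀ u v s, IsC1Curve u v → (∀ r ∈ Icc (s - h) s, ‖u r‖ ≤ R ∧ ‖v r‖ ≤ R) →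
      ‖N u v s‖ ≤ K := by
  obtain ⟨Λ, hΛ0, hΛ⟩ := hN.lipschitz (max R 1) (by positivity)
  set z : ℝ → E := fun _ => 0
  refine ⟨Λ * max R 1 + ‖N z z 0‖, by positivity, fun u v s hu hb => ?_⟩
  have hz : N z z s = N z z 0 := by
    have := hN.shift z z s 0
    rw [zero_add] at this
    exact this.symm
  have := hΛ u v z z s (max R 1) hu isC1Curve_zero
    (fun r hr => ⟨(hb r hr).1.trans (le_max_left _ _), (hb r hr).2.trans (le_max_left _ _),
      by simp [z], by simp [z]⟩)
    (fun r hr => by simpa [z] using ⟨Or.inl (hb r hr).1, Or.inl (hb r hr).2⟩)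
  rw [hz] at this
  calc ‖N u v s‖ = ‖(N u v s - N z z 0) + N z z 0‖ := by simp
    _ ≤ _ := (norm_add_le _ _).trans (by gcongr)

lemma IsDelayField.continuous (hN : IsDelayField h N) (hu : IsC1Curve u v) :
    Continuous (N u v) := by
  rw [Metric.continuous_iff]
  intro s ε hε
  obtain ⟨R, hR, hb⟩ := hu.exists_bound (s - h - 1) (s + 1)
  obtain ⟨Λ, hΛ0, hΛ⟩ := hN.lipschitz R hR
  have hK : IsCompact (Icc (s - h - 1) (s + 1)) := isCompact_Icc
  have huc := Metric.uniformContinuousOn_iff.1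
    (hK.uniformContinuousOn_of_continuous hu.continuous.continuousOn)
    (ε / (2 * (Λ + 1))) (by positivity)
  have hvc := Metric.uniformContinuousOn_iff.1
    (hK.uniformContinuousOn_of_continuous hu.2.continuousOn)
    (ε / (2 * (Λ + 1))) (by positivity)
  obtain ⟨δ₁, hδ₁, H₁⟩ := huc
  obtain ⟨δ₂, hδ₂, H₂⟩ := hvc
  refine ⟨min 1 (min δ₁ δ₂), by positivity, fun t ht => ?_⟩
  rw [lt_min_iff, lt_min_iff, Real.dist_eq] at ht
  obtain ⟨ht1, ht2, ht3⟩ := ht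
  have ht1' := abs_lt.1 ht1
  have key := hΛ (fun r => u (r + (t - s))) (fun r => v (r + (t - s))) u v s
    (ε / (2 * (Λ + 1))) (hu.shift _) hu
    (fun r hr => by
      have h1 := hb (r + (t - s)) ⟨by linarith [hr.1], by linarith [hr.2]⟩
      have h2 := hb r ⟨by linarith [hr.1], by linarith [hr.2]⟩
      exact ⟨h1.1, h1.2, h2.1, h2.2⟩)
    (fun r hr => by
      have m1 : r + (t - s) ∈ Icc (s - h - 1) (s + 1) :=
        ⟨by linarith [hr.1], by linarith [hr.2]⟩
      have m2 : r ∈ Icc (s - h - 1) (s + 1) := ⟨by linarith [hr.1], by linarith [hr.2]⟩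
      rw [← dist_eq_norm, ← dist_eq_norm]
      exact ⟨(H₁ _ m1 _ m2 (by simpa [Real.dist_eq] using ht2)).le,
        (H₂ _ m1 _ m2 (by simpa [Real.dist_eq] using ht3)).le⟩)
  rw [hN.shift, show s + (t - s) = t by ring, ← dist_eq_norm] at key
  refine key.trans_lt ?_
  rw [mul_div_assoc', div_lt_iff₀ (by positivity)]
  nlinarith

lemma IsTraj.mono {a b : ℝ} (hu : IsTraj N a u v) (hab : a ≤ b) : IsTraj N b u v :=
  ⟨hu.1, fun s t hs => hu.2 s t (hab.trans hs)⟩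

lemma IsTraj.shift (hN : IsDelayField h N) {a : ℝ} (hu : IsTraj N a u v) (c : ℝ) :
    IsTraj N (a - c) (fun t => u (t + c)) (fun t => v (t + c)) := by
  refine ⟨hu.1.shift c, fun s t hs hst => ?_⟩
  have := hu.2 (s + c) (t + c) (by linarith) (by linarith)
  simp only [hN.shift]
  rw [this, intervalIntegral.integral_comp_add_right (fun r => N u v r)]

lemma IsTraj.norm_sub_le {a R K : ℝ} (hu : IsTraj N a u v)
    (hK : ∀ w z s, IsC1Curve w z → (∀ r ∈ Icc (s - h) s, ‖w r‖ ≤ R ∧ ‖z r‖ ≤ R) → ‖N w z s‖ ≤ K)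
    (hb : ∀ r, a - h ≤ r → ‖u r‖ ≤ R ∧ ‖v r‖ ≤ R) {s t : ℝ} (hs : a ≤ s) (ht : a ≤ t) :
    ‖v t - v s‖ ≤ K * |t - s| := by
  wlog hst : s ≤ t generalizing s t
  · rw [norm_sub_rev, abs_sub_comm]
    exact this ht hs (le_of_not_ge hst)
  rw [hu.2 s t hs hst, sub_sub_cancel_left, norm_neg]
  refine intervalIntegral.norm_integral_le_of_norm_le_const fun r hr => ?_
  rw [uIoc_of_le hst] at hr
  exact hK u v r hu.1 fun q hq => hb q (by linarith [hq.1, hr.1])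

/-- Trajectories are determined by their history on `[-h,0]`. -/
lemma IsTraj.eq_of_eq_history [CompleteSpace E] (hh : 0 ≤ h) (hN : IsDelayField h N)
    {u₁ v₁ u₂ v₂ : ℝ → E}
    (h₁ : IsTraj N 0 u₁ v₁) (h₂ : IsTraj N 0 u₂ v₂)
    (heq : ∀ r ∈ Icc (-h) 0, u₁ r = u₂ r ∧ v₁ r = v₂ r) :
    ∀ t, -h ≤ t → u₁ t = u₂ t ∧ v₁ t = v₂ t := by
  intro T hT
  rcases le_or_gt T 0 with hT0 | hT0
  · exact heq T ⟨hT, hT0⟩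
  obtain ⟨R₁, hR₁, hb₁⟩ := h₁.1.exists_bound (-h) T
  obtain ⟨R₂, hR₂, hb₂⟩ := h₂.1.exists_bound (-h) T
  obtain ⟨Λ₀, hΛ₀, hΛ⟩ := hN.lipschitz (max R₁ R₂) (by positivity)
  set Λ := Λ₀ + 1 with hΛdef
  set d : ℝ → ℝ := fun t => max ‖u₁ t - u₂ t‖ ‖v₁ t - v₂ t‖ with hd
  have hdc : Continuous d :=
    ((h₁.1.continuous.sub h₂.1.continuous).norm).max ((h₁.1.2.sub h₂.1.2).norm)
  have hd0 : ∀ t, 0 ≤ d t := fun t => le_max_of_le_left (norm_nonneg _)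
  obtain ⟨tm, htm, hmax⟩ := (isCompact_Icc (a := (0:ℝ)) (b := T)).exists_isMaxOn
    ⟨0, by simp [hT0.le]⟩ (f := fun t => rexp (-(2 * Λ * t)) * d t)
    (by fun_prop)
  set m := rexp (-(2 * Λ * tm)) * d tm with hm
  have hm0 : 0 ≤ m := mul_nonneg (exp_pos _).le (hd0 _)
  have hle : ∀ t ∈ Icc (-h) T, d t ≤ m * rexp (2 * Λ * t) := by
    intro t ht
    rcases le_or_gt t 0 with h0 | h0
    · have := heq t ⟨ht.1, h0⟩
      have : d t = 0 := by simp [hd, this]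
      rw [this]
      positivity
    · have := hmax ⟨h0.le, ht.2⟩
      simp only [mem_ofPred_eq] at this
      calc d t = (rexp (-(2 * Λ * t)) * d t) * rexp (2 * Λ * t) := by
            rw [mul_right_comm, ← exp_add]; simp
        _ ≤ _ := by gcongr
  have hInt : ∀ t ∈ Icc 0 T, ∫ s in (0:ℝ)..t, Λ * (m * rexp (2 * Λ * s)) ≤
      m * rexp (2 * Λ * t) / 2 := by
    intro t ht
    have : ∫ s in (0:ℝ)..t, Λ * (m * rexp (2 * Λ * s)) =
        m * rexp (2 * Λ * t) / 2 - m * rexp (2 * Λ * 0) / 2 := by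
      refine intervalIntegral.integral_eq_sub_of_hasDerivAt
        (f := fun s => m * rexp (2 * Λ * s) / 2) (fun s _ => ?_)
        ((by fun_prop : Continuous _).intervalIntegrable _ _)
      have := (((hasDerivAt_id s).const_mul (2 * Λ)).exp.const_mul m).div_const 2
      exact this.congr_deriv (by simp only [id]; ring)
    rw [this]
    simp
    positivity
  have hstep : ∀ t ∈ Icc 0 T, d t ≤ m * rexp (2 * Λ * t) / 2 := by
    intro t ht
    have hsub : Icc (0:ℝ) t ⊆ Icc (-h) T := Icc_subset_Icc (by linarith) ht.2
    have e0 := heq 0 ⟨by linarith, le_rfl⟩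
    refine (max_le ?_ ?_).trans (hInt t ht)
    · have : u₁ t - u₂ t = ∫ s in (0:ℝ)..t, (v₁ s - v₂ s) := by
        rw [intervalIntegral.integral_sub (h₁.1.2.intervalIntegrable _ _)
          (h₂.1.2.intervalIntegrable _ _), ← h₁.1.sub_eq_integral, ← h₂.1.sub_eq_integral, e0.1]
        abel
      rw [this]
      refine intervalIntegral.norm_integral_le_of_norm_le ht.1 (.of_forall fun s hs => ?_)
        ((by fun_prop : Continuous _).intervalIntegrable _ _)
      have h3 := hle s (hsub ⟨hs.1.le, hs.2⟩)
      have h4 : ‖v₁ s - v₂ s‖ ≤ d s := le_max_right _ _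
      have h5 : 0 ≤ m * rexp (2 * Λ * s) := by positivity
      rw [hΛdef] at *
      nlinarith
    · have : v₁ t - v₂ t = -∫ s in (0:ℝ)..t, (N u₁ v₁ s - N u₂ v₂ s) := by
        rw [intervalIntegral.integral_sub ((hN.continuous h₁.1).intervalIntegrable _ _)
          ((hN.continuous h₂.1).intervalIntegrable _ _), h₁.2 0 t le_rfl ht.1,
          h₂.2 0 t le_rfl ht.1, e0.2]
        abel
      rw [this, norm_neg]
      refine intervalIntegral.norm_integral_le_of_norm_le ht.1 (.of_forall fun s hs => ?_)
        ((by fun_prop : Continuous _).intervalIntegrable _ _)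
      have h5 : 0 ≤ m * rexp (2 * Λ * s) := by positivity
      refine (hΛ u₁ v₁ u₂ v₂ s (m * rexp (2 * Λ * s)) h₁.1 h₂.1 ?_ ?_).trans ?_
      · intro r hr
        have hr' : r ∈ Icc (-h) T := ⟨by linarith [hr.1, hs.1], hr.2.trans (hs.2.trans ht.2)⟩
        exact ⟨(hb₁ r hr').1.trans (le_max_left _ _), (hb₁ r hr').2.trans (le_max_left _ _),
          (hb₂ r hr').1.trans (le_max_right _ _), (hb₂ r hr').2.trans (le_max_right _ _)⟩
      · intro r hr
        have hr' : r ∈ Icc (-h) T := ⟨by linarith [hr.1, hs.1], hr.2.trans (hs.2.trans ht.2)⟩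
        have : d r ≤ m * rexp (2 * Λ * s) := (hle r hr').trans (by gcongr; exact hr.2)
        exact ⟨(le_max_left _ _).trans this, (le_max_right _ _).trans this⟩
      · gcongr
        linarith
  have hmz : m = 0 := by
    have := hstep tm htm
    have h2 : d tm = m * rexp (2 * Λ * tm) := by
      rw [hm, mul_right_comm, ← exp_add]; simp
    have h3 : 0 < rexp (2 * Λ * tm) := exp_pos _
    nlinarith
  have h6 : d T ≤ 0 := by simpa [hmz] using hle T ⟨hT, le_rfl⟩
  exact ⟨sub_eq_zero.1 (norm_le_zero_iff.1 ((le_max_left _ _).trans h6)),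
    sub_eq_zero.1 (norm_le_zero_iff.1 ((le_max_right _ _).trans h6))⟩

/-- A uniformly bounded family of trajectories whose starting times tend to `-∞` converges locally
uniformly, along an ultrafilter, to a complete trajectory. -/
lemma exists_complete_limit [ProperSpace E] (hN : IsDelayField h N) {ι : Type*}
    (𝒰 : Ultrafilter ι) (U V : ι → ℝ → E) {L : ℝ} (hL : 0 < L)
    (htraj : ∀ b, ∀ᶠ i in (𝒰 : Filter ι), IsTraj N b (U i) (V i))
    (hU0 : ∀ᶠ i in (𝒰 : Filter ι), ‖U i 0‖ ≤ L)
    (hV : ∀ᶠ i in (𝒰 : Filter ι), ∀ t, ‖V i t‖ ≤ L)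
    (hVL : ∀ᶠ i in (𝒰 : Filter ι), ∀ s t, ‖V i t - V i s‖ ≤ L * |t - s|) :
    ∃ u v : ℝ → E, (∀ b, IsTraj N b u v) ∧ TendstoLocallyUniformly U u (𝒰 : Filter ι) ∧
      TendstoLocallyUniformly V v (𝒰 : Filter ι) := by
  obtain ⟨u, -, hu⟩ := exists_tendstoLocallyUniformly_of_lipschitz 𝒰 U L hL.le
    (by filter_upwards [htraj 0, hV] with i h1 h2 s t using h1.1.norm_sub_le fun r _ => h2 r) hU0
  obtain ⟨v, hvc, hv⟩ := exists_tendstoLocallyUniformly_of_lipschitz 𝒰 V L hL.le hVL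
    (by filter_upwards [hV] with i h2 using h2 0)
  have hut : ∀ t, Tendsto (fun i => U i t) 𝒰 (𝓝 (u t)) := fun t =>
    hu.tendstoLocallyUniformlyOn (s := univ) |>.tendsto_at (mem_univ t)
  have hvt : ∀ t, Tendsto (fun i => V i t) 𝒰 (𝓝 (v t)) := fun t =>
    hv.tendstoLocallyUniformlyOn (s := univ) |>.tendsto_at (mem_univ t)
  have hc1 : IsC1Curve u v := ⟨fun t => hasDerivAt_of_tendstoLocallyUniformlyOn isOpen_univ
    hv.tendstoLocallyUniformlyOn
    (by filter_upwards [htraj 0] with i h1 x _ using h1.1.1 x) (fun x _ => hut x) (mem_univ t), hvc⟩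
  refine ⟨u, v, fun b => ⟨hc1, fun s t _ hst => ?_⟩, hu, hv⟩
  obtain ⟨R, hR, hb⟩ := hc1.exists_bound (s - h) t
  obtain ⟨Λ, hΛ0, hΛ⟩ := hN.lipschitz (R + 1) (by positivity)
  have hInt : Tendsto (fun i => ∫ r in s..t, N (U i) (V i) r) 𝒰 (𝓝 (∫ r in s..t, N u v r)) := by
    rw [Metric.tendsto_nhds]
    intro ε hε
    set δ := min 1 (ε / (2 * (Λ + 1) * (t - s + 1))) with hδ
    have hts : 0 ≤ t - s := sub_nonneg.2 hst
    have hδ0 : 0 < δ := by positivity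
    filter_upwards [hu.eventually_norm_sub_le_Icc (s - h) t hδ0,
      hv.eventually_norm_sub_le_Icc (s - h) t hδ0, htraj 0] with i h1 h2 h3
    rw [dist_eq_norm, ← intervalIntegral.integral_sub
      ((hN.continuous h3.1).intervalIntegrable _ _) ((hN.continuous hc1).intervalIntegrable _ _)]
    have hle : ‖∫ r in s..t, (N (U i) (V i) r - N u v r)‖ ≤ (Λ * δ) * |t - s| := by
      refine intervalIntegral.norm_integral_le_of_norm_le_const fun r hr => ?_
      rw [uIoc_of_le hst] at hr
      have hsub : Icc (r - h) r ⊆ Icc (s - h) t := Icc_subset_Icc (by linarith [hr.1]) hr.2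
      refine hΛ _ _ _ _ _ _ h3.1 hc1 (fun q hq => ?_)
        fun q hq => ⟨h1 q (hsub hq), h2 q (hsub hq)⟩
      have b1 := hb q (hsub hq)
      have hδ1 : δ ≤ 1 := min_le_left _ _
      refine ⟨?_, ?_, by linarith, by linarith⟩
      · have := norm_le_norm_add_norm_sub' (U i q) (u q)
        linarith [h1 q (hsub hq)]
      · have := norm_le_norm_add_norm_sub' (V i q) (v q)
        linarith [h2 q (hsub hq)]
    refine hle.trans_lt ?_
    rw [abs_of_nonneg hts]
    have hδ2 : δ * (2 * (Λ + 1) * (t - s + 1)) ≤ ε :=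
      (le_div_iff₀ (by positivity)).1 (min_le_right _ _)
    nlinarith [mul_nonneg hδ0.le hΛ0, mul_nonneg hδ0.le hts,
      mul_nonneg (mul_nonneg hδ0.le hΛ0) hts]
  refine tendsto_nhds_unique (hvt t) (((hvt s).sub hInt).congr' ?_)
  filter_upwards [htraj s] with i h1
  exact (h1.2 s t le_rfl hst).symm

/-- Forgetting the history of a trajectory on `[-h,0)`, it can be replaced by a curve with
derivative constant before `0`. -/
lemma IsTraj.exists_cutoff [CompleteSpace E] (hN : IsDelayField h N) (hh : 0 ≤ h)
    (hu : IsTraj N 0 u v) :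
    ∃ u₁, IsTraj N h u₁ (fun t => v (max 0 t)) ∧ ∀ t, 0 ≤ t → u₁ t = u t := by
  obtain ⟨u₁, hc, heq⟩ := exists_isC1Curve_extension (u := u) (v := v) (a := 0)
    (fun t _ => (hu.1.1 t).hasDerivWithinAt) hu.1.2.continuousOn
  refine ⟨u₁, ⟨hc, fun s t hs hst => ?_⟩, heq⟩
  change v (max 0 t) = v (max 0 s) - _
  rw [max_eq_right (hh.trans hs), max_eq_right (hh.trans (hs.trans hst)),
    hu.2 s t (hh.trans hs) hst]
  congr 1
  refine intervalIntegral.integral_congr fun r hr => ?_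
  rw [uIcc_of_le hst] at hr
  refine hN.congr hu.1 hc fun q hq => ?_
  have hq0 : 0 ≤ q := by linarith [hq.1, hr.1]
  exact ⟨(heq q hq0).symm, by rw [max_eq_right hq0]⟩

end Abstract

/-! ### Existence of the attractor of a dissipative delay field -/

section Attractor

variable {n : ℕ} {h : ℝ} {N : (ℝ → Euc n) → (ℝ → Euc n) → ℝ → Euc n} {u v : ℝ → Euc n}

/-- The element of `W` given by the segment of a `C¹` curve. -/
def IsC1Curve.segment (h : ℝ) (hu : IsC1Curve u v) (t : ℝ) : Wc n h :=
  (⟨fun θ => u (t + θ.1), hu.continuous.comp (by fun_prop)⟩,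
    ⟨fun θ => v (t + θ.1), hu.2.comp (by fun_prop)⟩)

lemma IsC1Curve.isSegAt_segment (hu : IsC1Curve u v) (t : ℝ) :
    IsSegAt n h u v t (hu.segment h t) := fun _ => ⟨rfl, rfl⟩

lemma extIcc_apply {f : C(Icc (-h) (0:ℝ), Euc n)} {θ : ℝ} (hθ : θ ∈ Icc (-h) (0:ℝ)) :
    extIcc n h f θ = f ⟨θ, hθ⟩ := by
  simp only [extIcc]
  rw [dif_pos hθ]

lemma IsC1Curve.isC1Pair (hu : IsC1Curve u v) (t : ℝ) :
    IsC1Pair n h (fun θ => u (t + θ)) (fun θ => v (t + θ)) :=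
  ⟨fun θ _ => ((hu.1 (t + θ)).comp_const_add t θ).hasDerivWithinAt,
    (hu.2.comp (by fun_prop)).continuousOn⟩

lemma IsC1Pair.congr {φ φ' ψ ψ' : ℝ → Euc n} (hφ : IsC1Pair n h φ φ')
    (heq : ∀ θ ∈ Icc (-h) (0:ℝ), ψ θ = φ θ ∧ ψ' θ = φ' θ) : IsC1Pair n h ψ ψ' :=
  ⟨fun θ hθ => (heq θ hθ).2 ▸
      (hφ.1 θ hθ).congr (fun x hx => (heq x hx).1) (heq θ hθ).1,
    hφ.2.congr fun θ hθ => (heq θ hθ).2⟩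

lemma IsSegAt.inW {t : ℝ} {p : Wc n h} (hp : IsSegAt n h u v t p) (hu : IsC1Curve u v) :
    InW n h p :=
  (hu.isC1Pair t).congr fun θ hθ => by
    rw [extIcc_apply hθ, extIcc_apply hθ]
    exact hp ⟨θ, hθ⟩

lemma segWdist_le (hh : 0 ≤ h) {t ε : ℝ} {q : Wc n h}
    (hq : ∀ θ : Icc (-h) (0:ℝ), ‖u (t + θ.1) - q.1 θ‖ ≤ ε ∧ ‖v (t + θ.1) - q.2 θ‖ ≤ ε) :
    segWdist n h u v t q ≤ ε + ε := by
  have : Nonempty (Icc (-h) (0:ℝ)) := ⟨⟨0, by simpa using hh, le_rfl⟩⟩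
  exact add_le_add (ciSup_le fun θ => (hq θ).1) (ciSup_le fun θ => (hq θ).2)

/-- The segments of complete trajectories which stay in the ball of radius `R`. -/
def boundedCompleteSegments (n : ℕ) (h : ℝ) (N : (ℝ → Euc n) → (ℝ → Euc n) → ℝ → Euc n) (R : ℝ) :
    Set (Wc n h) :=
  {p | ∃ u v : ℝ → Euc n, (∀ b, IsTraj N b u v) ∧ (∀ t, ‖u t‖ ≤ R ∧ ‖v t‖ ≤ R) ∧
    IsSegAt n h u v 0 p}

lemma mem_boundedCompleteSegments_of_isSegAt (hN : IsDelayField h N) {R t : ℝ}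
    (hu : ∀ b, IsTraj N b u v) (hb : ∀ t, ‖u t‖ ≤ R ∧ ‖v t‖ ≤ R) {p : Wc n h}
    (hp : IsSegAt n h u v t p) : p ∈ boundedCompleteSegments n h N R := by
  refine ⟨fun s => u (s + t), fun s => v (s + t), fun b => ?_, fun s => hb (s + t), fun θ => ?_⟩
  · have := (hu (b + t)).shift hN t
    rwa [add_sub_cancel_right] at this
  · simpa [add_comm] using hp θ

lemma isCompact_boundedCompleteSegments (hN : IsDelayField h N) (R : ℝ) :
    IsCompact (boundedCompleteSegments n h N R) := by
  rw [isCompact_iff_ultrafilter_le_nhds]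
  intro 𝒰 h𝒰
  have hex : ∀ p : Wc n h, ∃ u v : ℝ → Euc n, p ∈ boundedCompleteSegments n h N R →
      (∀ b, IsTraj N b u v) ∧ (∀ t, ‖u t‖ ≤ R ∧ ‖v t‖ ≤ R) ∧ IsSegAt n h u v 0 p := by
    intro p
    by_cases hp : p ∈ boundedCompleteSegments n h N R
    · obtain ⟨u, v, H⟩ := hp
      exact ⟨u, v, fun _ => H⟩
    · exact ⟨0, 0, fun H => absurd H hp⟩
  choose U V hUV using hex
  have hev : ∀ᶠ p in (𝒰 : Filter (Wc n h)), (∀ b, IsTraj N b (U p) (V p)) ∧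
      (∀ t, ‖U p t‖ ≤ R ∧ ‖V p t‖ ≤ R) ∧ IsSegAt n h (U p) (V p) 0 p := by
    filter_upwards [le_principal_iff.1 h𝒰] with p hp using hUV p hp
  obtain ⟨K, hK0, hK⟩ := hN.exists_bound R
  set L := max 1 (max K R) with hLdef
  have hL : 0 < L := by positivity
  have hRL : R ≤ L := (le_max_right _ _).trans (le_max_right _ _)
  have hKL : K ≤ L := (le_max_left _ _).trans (le_max_right _ _)
  obtain ⟨u, v, htraj, hu, hv⟩ := exists_complete_limit hN 𝒰 U V hL
    (fun b => by filter_upwards [hev] with p hp using hp.1 b)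
    (by filter_upwards [hev] with p hp using (hp.2.1 0).1.trans hRL)
    (by filter_upwards [hev] with p hp t using (hp.2.1 t).2.trans hRL)
    (by
      filter_upwards [hev] with p hp s t
      exact ((hp.1 (min s t)).norm_sub_le hK (fun r _ => hp.2.1 r) (min_le_left _ _)
        (min_le_right _ _)).trans (by gcongr))
  have hb : ∀ t, ‖u t‖ ≤ R ∧ ‖v t‖ ≤ R := fun t =>
    ⟨le_of_tendsto (hu.tendstoLocallyUniformlyOn (s := univ) |>.tendsto_at (mem_univ t)).norm
      (by filter_upwards [hev] with p hp using (hp.2.1 t).1),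
    le_of_tendsto (hv.tendstoLocallyUniformlyOn (s := univ) |>.tendsto_at (mem_univ t)).norm
      (by filter_upwards [hev] with p hp using (hp.2.1 t).2)⟩
  have hseg := (htraj 0).1.isSegAt_segment (h := h) 0
  refine ⟨(htraj 0).1.segment h 0, mem_boundedCompleteSegments_of_isSegAt hN htraj hb hseg, ?_⟩
  change Tendsto id (𝒰 : Filter (Wc n h)) _
  rw [Metric.tendsto_nhds]
  intro ε hε
  filter_upwards [hev, hu.eventually_norm_sub_le_Icc (-h) 0 (half_pos hε),
    hv.eventually_norm_sub_le_Icc (-h) 0 (half_pos hε)] with p hp h1 h2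
  refine lt_of_le_of_lt ?_ (half_lt_self hε)
  refine max_le ((ContinuousMap.dist_le (half_pos hε).le).2 fun θ => ?_)
    ((ContinuousMap.dist_le (half_pos hε).le).2 fun θ => ?_)
  · have := h1 θ θ.2
    rw [dist_eq_norm, id, (hp.2.2 θ).1, (hseg θ).1]
    simpa using this
  · have := h2 θ θ.2
    rw [dist_eq_norm, id, (hp.2.2 θ).2, (hseg θ).2]
    simpa using this

/-- Trajectories from bounded sets approach the bounded complete trajectories uniformly. -/
lemma boundedCompleteSegments_attracts (hh : 0 ≤ h) (hN : IsDelayField h N) {R R' T₀ : ℝ}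
    (S : Set ((ℝ → Euc n) × (ℝ → Euc n))) (hS : ∀ w ∈ S, IsTraj N 0 w.1 w.2)
    (hR' : ∀ w ∈ S, ∀ t, -h ≤ t → ‖w.1 t‖ ≤ R' ∧ ‖w.2 t‖ ≤ R')
    (hR : ∀ w ∈ S, ∀ t, T₀ ≤ t → ‖w.1 t‖ ≤ R ∧ ‖w.2 t‖ ≤ R) {ε : ℝ} (hε : 0 < ε) :
    ∃ T ≥ (0:ℝ), ∀ w ∈ S, ∀ t ≥ T, ∃ q ∈ boundedCompleteSegments n h N R,
      segWdist n h w.1 w.2 t q ≤ ε := by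
  by_contra! hcon
  choose w hwS t ht hfar using fun j : ℕ => hcon j j.cast_nonneg
  choose U hU hUeq using fun j => (hS _ (hwS j)).exists_cutoff hN hh
  obtain ⟨K, hK0, hK⟩ := hN.exists_bound R'
  set L := max 1 (max K R') with hLdef
  have hL : 0 < L := by positivity
  have hRL : R' ≤ L := (le_max_right _ _).trans (le_max_right _ _)
  have hKL : K ≤ L := (le_max_left _ _).trans (le_max_right _ _)
  have ht0 : ∀ j, 0 ≤ t j := fun j => j.cast_nonneg.trans (ht j)
  have htop : ∀ b : ℝ, ∀ᶠ j in ((hyperfilter ℕ : Ultrafilter ℕ) : Filter ℕ), b ≤ t j := by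
    intro b
    have h1 : ∀ᶠ j : ℕ in atTop, b ≤ (j : ℝ) := tendsto_natCast_atTop_atTop.eventually_ge_atTop b
    filter_upwards [Nat.hyperfilter_le_atTop h1] with j hj using le_trans hj (ht j)
  obtain ⟨u, v, htraj, hu, hv⟩ := exists_complete_limit hN (hyperfilter ℕ)
    (fun j s => U j (s + t j)) (fun j s => (w j).2 (max 0 (s + t j))) hL
    (fun b => by
      filter_upwards [htop (h - b)] with j hj
      exact ((hU j).shift hN (t j)).mono (by linarith))
    (.of_forall fun j => by
      rw [zero_add, hUeq j _ (ht0 j)]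
      exact (hR' _ (hwS j) _ (by linarith [ht0 j])).1.trans hRL)
    (.of_forall fun j s => (hR' _ (hwS j) _ (by linarith [le_max_left 0 (s + t j)])).2.trans hRL)
    (.of_forall fun j s r => by
      refine ((hS _ (hwS j)).norm_sub_le hK (fun q hq => hR' _ (hwS j) q (by linarith))
        (le_max_left _ _) (le_max_left _ _)).trans ?_
      refine mul_le_mul hKL ?_ (abs_nonneg _) hL.le
      refine (abs_max_sub_max_le_max _ _ _ _).trans ?_
      simp)
  have htail : ∀ s, ∀ᶠ j in ((hyperfilter ℕ : Ultrafilter ℕ) : Filter ℕ),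
      U j (s + t j) = (w j).1 (s + t j) ∧ (w j).2 (max 0 (s + t j)) = (w j).2 (s + t j) ∧
        T₀ ≤ s + t j := by
    intro s
    filter_upwards [htop (-s), htop (T₀ - s)] with j h1 h2
    exact ⟨hUeq j _ (by linarith), by rw [max_eq_right (by linarith)], by linarith⟩
  have hb : ∀ s, ‖u s‖ ≤ R ∧ ‖v s‖ ≤ R := fun s =>
    ⟨le_of_tendsto (hu.tendstoLocallyUniformlyOn (s := univ) |>.tendsto_at (mem_univ s)).norm
      (by
        filter_upwards [htail s] with j hj
        rw [hj.1]
        exact (hR _ (hwS j) _ hj.2.2).1),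
    le_of_tendsto (hv.tendstoLocallyUniformlyOn (s := univ) |>.tendsto_at (mem_univ s)).norm
      (by
        filter_upwards [htail s] with j hj
        rw [hj.2.1]
        exact (hR _ (hwS j) _ hj.2.2).2)⟩
  have hseg := (htraj 0).1.isSegAt_segment (h := h) 0
  obtain ⟨j, hj1, hj2, hj3⟩ := ((hu.eventually_norm_sub_le_Icc (-h) 0 (half_pos hε)).and
    ((hv.eventually_norm_sub_le_Icc (-h) 0 (half_pos hε)).and (htop h))).exists
  refine absurd (hfar j _ (mem_boundedCompleteSegments_of_isSegAt hN htraj hb hseg)) (not_lt.2 ?_)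
  rw [← add_halves ε]
  refine segWdist_le hh fun θ => ?_
  have hθ : 0 ≤ θ.1 + t j := by linarith [θ.2.1]
  have h1 := hj1 θ θ.2
  have h2 := hj2 θ θ.2
  rw [hUeq j _ hθ] at h1
  rw [max_eq_right hθ] at h2
  rw [(hseg θ).1, (hseg θ).2, zero_add, add_comm (t j)]
  exact ⟨h1, h2⟩

/-- A dissipative delay field has a compact global attractor. -/
theorem IsDelayField.exists_attractor (hh : 0 ≤ h) (hN : IsDelayField h N) {R : ℝ}
    (hdiss : ∀ r, ∃ R' T₀, ∀ u v, IsTraj N 0 u v →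
      (∀ t ∈ Icc (-h) 0, ‖u t‖ ≤ r ∧ ‖v t‖ ≤ r) →
      (∀ t, -h ≤ t → ‖u t‖ ≤ R' ∧ ‖v t‖ ≤ R') ∧ ∀ t, T₀ ≤ t → ‖u t‖ ≤ R ∧ ‖v t‖ ≤ R) :
    ∃ 𝔄 : Set (Wc n h), IsCompact 𝔄 ∧ (∀ p ∈ 𝔄, InW n h p) ∧
      (∀ p ∈ 𝔄, ∀ t ≥ (0:ℝ),
        (∀ u v, IsTraj N 0 u v → IsSegAt n h u v 0 p → ∃ q ∈ 𝔄, IsSegAt n h u v t q) ∧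
        ∃ q ∈ 𝔄, ∀ u v, IsTraj N 0 u v → IsSegAt n h u v 0 q → IsSegAt n h u v t p) ∧
      ∀ B : Set (Wc n h), Bornology.IsBounded B → ∀ ε > (0:ℝ), ∃ T ≥ (0:ℝ), ∀ p ∈ B,
        ∀ t ≥ T, ∀ u v, IsTraj N 0 u v → IsSegAt n h u v 0 p →
          ∃ q ∈ 𝔄, segWdist n h u v t q ≤ ε := by
  have hhist : ∀ {u v u₁ v₁ : ℝ → Euc n} {s : ℝ} {p : Wc n h}, (∀ b, IsTraj N b u v) →
      IsTraj N 0 u₁ v₁ → IsSegAt n h u v s p → IsSegAt n h u₁ v₁ 0 p →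
      ∀ t, -h ≤ t → u₁ t = u (t + s) ∧ v₁ t = v (t + s) := by
    intro u v u₁ v₁ s p hu hu₁ hp hp₁
    have hsh := (hu (0 + s)).shift hN s
    rw [add_sub_cancel_right] at hsh
    refine hu₁.eq_of_eq_history hh hN hsh fun r hr => ?_
    have e1 := hp ⟨r, hr⟩
    have e2 := hp₁ ⟨r, hr⟩
    simp only [zero_add] at e2
    rw [← e2.1, ← e2.2, e1.1, e1.2, add_comm s]
    exact ⟨rfl, rfl⟩
  refine ⟨boundedCompleteSegments n h N R, isCompact_boundedCompleteSegments hN R, ?_, ?_, ?_⟩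
  · rintro p ⟨u, v, hu, -, hp⟩
    exact hp.inW (hu 0).1
  · rintro p ⟨u, v, hu, hb, hp⟩ t ht
    constructor
    · intro u₁ v₁ hu₁ hp₁
      have heq := hhist hu hu₁ hp hp₁
      have hq := (hu 0).1.isSegAt_segment (h := h) t
      refine ⟨_, mem_boundedCompleteSegments_of_isSegAt hN hu hb hq, fun θ => ?_⟩
      have := heq (t + θ.1) (by linarith [θ.2.1])
      rw [add_zero] at this
      rw [this.1, this.2]
      exact hq θ
    · have hq := (hu 0).1.isSegAt_segment (h := h) (-t)
      refine ⟨_, mem_boundedCompleteSegments_of_isSegAt hN hu hb hq, fun u₁ v₁ hu₁ hp₁ θ => ?_⟩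
      have := hhist hu hu₁ hq hp₁ (t + θ.1) (by linarith [θ.2.1])
      rw [this.1, this.2, show t + θ.1 + -t = 0 + θ.1 by ring]
      exact hp θ
  · intro B hB ε hε
    obtain ⟨r, hr⟩ := hB.exists_norm_le
    obtain ⟨R', T₀, hdiss⟩ := hdiss r
    have hbd : ∀ p ∈ B, ∀ u v, IsSegAt n h u v 0 p →
        ∀ t ∈ Icc (-h) 0, ‖u t‖ ≤ r ∧ ‖v t‖ ≤ r := by
      intro p hp u v hseg t ht
      have e := hseg ⟨t, ht⟩
      simp only [zero_add] at e
      rw [← e.1, ← e.2]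
      exact ⟨(p.1.norm_coe_le_norm _).trans ((norm_fst_le p).trans (hr p hp)),
        (p.2.norm_coe_le_norm _).trans ((norm_snd_le p).trans (hr p hp))⟩
    obtain ⟨T, hT, H⟩ := boundedCompleteSegments_attracts hh hN
      {w | IsTraj N 0 w.1 w.2 ∧ ∃ p ∈ B, IsSegAt n h w.1 w.2 0 p} (R := R) (R' := R') (T₀ := T₀)
      (fun w hw => hw.1)
      (fun w hw => by
        obtain ⟨h1, p, hp, hseg⟩ := hw
        exact (hdiss _ _ h1 (hbd p hp _ _ hseg)).1)
      (fun w hw => by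
        obtain ⟨h1, p, hp, hseg⟩ := hw
        exact (hdiss _ _ h1 (hbd p hp _ _ hseg)).2) hε
    exact ⟨T, hT, fun p hp t ht u v hu hseg => H (u, v) ⟨hu, p, hp, hseg⟩ t ht⟩

end Attractor

/-! ### Energy estimates -/

section Energy

/-- The double integral `∫_{t-h}^t ∫_s^t w`, as a Lyapunov functional for a delay term. -/
lemma exists_delay_functional {w : ℝ → ℝ} (hw : Continuous w) (hw0 : ∀ t, 0 ≤ w t) {h : ℝ}
    (hh : 0 ≤ h) :
    ∃ D : ℝ → ℝ, (∀ t, HasDerivAt D (h * w t - ∫ s in (t - h)..t, w s) t) ∧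
      ∀ t, 0 ≤ D t ∧ D t ≤ h * ∫ s in (t - h)..t, w s := by
  have prim : ∀ {f : ℝ → ℝ}, Continuous f → ∀ t,
      HasDerivAt (fun t => ∫ s in (0:ℝ)..t, f s) (f t) t :=
    fun hf t => intervalIntegral.integral_hasDerivAt_right (hf.intervalIntegrable _ _)
      (hf.stronglyMeasurableAtFilter _ _) hf.continuousAt
  set W : ℝ → ℝ := fun t => ∫ s in (0:ℝ)..t, w s with hW
  have hWd : ∀ t, HasDerivAt W (w t) t := prim hw
  have hWc : Continuous W := continuous_iff_continuousAt.2 fun t => (hWd t).continuousAt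
  have hWsub : ∀ s t, ∫ r in s..t, w r = W t - W s := fun s t =>
    (intervalIntegral.integral_interval_sub_left (hw.intervalIntegrable _ _)
      (hw.intervalIntegrable _ _)).symm
  have hWm : Monotone W := monotone_of_hasDerivAt_nonneg hWd hw0
  set Z : ℝ → ℝ := fun t => ∫ s in (0:ℝ)..t, W s with hZ
  have hZd : ∀ t, HasDerivAt Z (W t) t := prim hWc
  have hZsub : ∀ t, Z t - Z (t - h) = ∫ s in (t - h)..t, W s := fun t =>
    intervalIntegral.integral_interval_sub_left (hWc.intervalIntegrable _ _)
      (hWc.intervalIntegrable _ _)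
  refine ⟨fun t => h * W t - (Z t - Z (t - h)), fun t => ?_, fun t => ?_⟩
  · rw [hWsub]
    exact ((hWd t).const_mul h).sub ((hZd t).sub ((hZd (t - h)).comp_sub_const t h))
  · simp only [hZsub, hWsub]
    have hle : t - h ≤ t := by linarith
    have h1 : ∫ s in (t - h)..t, W s ≤ ∫ s in (t - h)..t, W t :=
      intervalIntegral.integral_mono_on hle (hWc.intervalIntegrable _ _) (by simp)
        fun s hs => hWm hs.2
    have h2 : ∫ s in (t - h)..t, W (t - h) ≤ ∫ s in (t - h)..t, W s :=
      intervalIntegral.integral_mono_on hle (by simp) (hWc.intervalIntegrable _ _)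
        fun s hs => hWm hs.1
    simp only [intervalIntegral.integral_const, smul_eq_mul, sub_sub_cancel] at h1 h2
    constructor <;> linarith

lemma le_of_deriv_le_sub_mul {Y Y' : ℝ → ℝ} {K δ : ℝ} (hδ : 0 < δ) (hc : ContinuousOn Y (Ici 0))
    (hd : ∀ t > 0, HasDerivAt Y (Y' t) t) (hle : ∀ t > 0, Y' t ≤ K - δ * Y t) :
    ∀ t ≥ 0, Y t ≤ K / δ + (Y 0 - K / δ) * rexp (-(δ * t)) := by
  intro t ht
  have hder : ∀ s > 0, HasDerivAt (fun s => rexp (δ * s) * (Y s - K / δ))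
      (rexp (δ * s) * (δ * (Y s - K / δ) + Y' s)) s := fun s hs =>
    ((((hasDerivAt_id s).const_mul δ).exp).mul ((hd s hs).sub_const (K / δ))).congr_deriv
      (by simp only [id]; ring)
  have hanti : AntitoneOn (fun s => rexp (δ * s) * (Y s - K / δ)) (Ici 0) := by
    refine antitoneOn_of_deriv_nonpos (convex_Ici 0) ?_ ?_ ?_
    · exact (by fun_prop : Continuous fun s => rexp (δ * s)).continuousOn.mul
        (hc.sub continuousOn_const)
    · rw [interior_Ici]
      exact fun s hs => (hder s hs).differentiableAt.differentiableWithinAt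
    · rw [interior_Ici]
      intro s hs
      rw [(hder s hs).deriv]
      refine mul_nonpos_of_nonneg_of_nonpos (exp_pos _).le ?_
      have := hle s hs
      rw [mul_sub, mul_div_cancel₀ _ hδ.ne']
      linarith
  have := hanti self_mem_Ici ht ht
  simp only [mul_zero, Real.exp_zero, one_mul] at this
  have h2 : Y t - K / δ = (rexp (δ * t) * (Y t - K / δ)) * rexp (-(δ * t)) := by
    rw [mul_right_comm, ← exp_add]
    simp
  have h3 := mul_le_mul_of_nonneg_right this (exp_pos (-(δ * t))).le
  linarith

variable {E : Type*} [NormedAddCommGroup E] [InnerProductSpace ℝ E]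

lemma IsC1Curve.norm_sub_sq_le [CompleteSpace E] {u v : ℝ → E} (hu : IsC1Curve u v) {h σ : ℝ}
    (hh : 0 < h) (hσ : σ ∈ Icc 0 h) (t : ℝ) :
    ‖u (t - σ) - u t‖ ^ 2 ≤ h * ∫ s in (t - h)..t, ‖v s‖ ^ 2 := by
  have hnc : Continuous fun s => ‖v s‖ := hu.2.norm
  set S := ∫ s in (t - h)..t, ‖v s‖ with hS
  have h1 : ‖u (t - σ) - u t‖ ≤ S := by
    rw [norm_sub_rev, hu.sub_eq_integral]
    refine (intervalIntegral.norm_integral_le_integral_norm (by linarith [hσ.1])).trans ?_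
    exact intervalIntegral.integral_mono_interval (by linarith [hσ.2]) (by linarith [hσ.1]) le_rfl
      (.of_forall fun s => norm_nonneg _) (hnc.intervalIntegrable _ _)
  have hS0 : 0 ≤ S := (norm_nonneg _).trans h1
  have h2 : 0 ≤ ∫ s in (t - h)..t, (‖v s‖ - S / h) ^ 2 :=
    intervalIntegral.integral_nonneg (by linarith) fun s _ => sq_nonneg _
  have h3 : ∫ s in (t - h)..t, (‖v s‖ - S / h) ^ 2 =
      (∫ s in (t - h)..t, ‖v s‖ ^ 2) - 2 * (S / h) * S + (S / h) ^ 2 * h := by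
    have e : ∀ s, (‖v s‖ - S / h) ^ 2 = ‖v s‖ ^ 2 - 2 * (S / h) * ‖v s‖ + (S / h) ^ 2 :=
      fun s => by ring
    simp only [e]
    rw [intervalIntegral.integral_add, intervalIntegral.integral_sub,
      intervalIntegral.integral_const_mul, intervalIntegral.integral_const]
    · simp only [smul_eq_mul, sub_sub_cancel, ← hS]
      ring
    all_goals exact (by fun_prop : Continuous _).intervalIntegrable _ _
  have h4 : (S / h) * h = S := div_mul_cancel₀ _ hh.ne'
  have h5 : S ^ 2 ≤ h * ∫ s in (t - h)..t, ‖v s‖ ^ 2 := by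
    rw [h3] at h2
    set q := S / h
    rw [← h4] at h2 ⊢
    nlinarith
  exact (pow_le_pow_left₀ (norm_nonneg _) h1 2).trans h5

lemma sq_le_three_mul_of_le_add {p a b c : ℝ} (hp : 0 ≤ p) (h : p ≤ a + b + c) :
    p ^ 2 ≤ 3 * (a ^ 2 + b ^ 2 + c ^ 2) :=
  (pow_le_pow_left₀ hp h 2).trans
    (by linarith [sq_nonneg (a - b), sq_nonneg (a - c), sq_nonneg (b - c)])

lemma neg_inner_le (v f : E) {c : ℝ} (hc : 0 < c) :
    -⟪v, f⟫ ≤ c / 8 * ‖v‖ ^ 2 + 2 / c * ‖f‖ ^ 2 := by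
  have h1 := neg_le_of_abs_le (abs_real_inner_le_norm v f)
  have h2 : 0 ≤ (c / 8) * (‖v‖ - 4 / c * ‖f‖) ^ 2 := by positivity
  have h3 : (c / 8) * (‖v‖ - 4 / c * ‖f‖) ^ 2 =
      c / 8 * ‖v‖ ^ 2 + 2 / c * ‖f‖ ^ 2 - ‖v‖ * ‖f‖ := by
    field_simp
    ring
  linarith

variable {A : E →L[ℝ] E} {F Fstar G : E → E} {Pot Pot0 Pot1 : E → ℝ}

/-- The energy of the state `(x, v)`, perturbed to make it a Lyapunov function. -/
def perturbedEnergy (A : E →L[ℝ] E) (Pot : E → ℝ) (γ k : ℝ) (x v : E) : ℝ :=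
  (‖v‖ ^ 2 + ⟪A x, x⟫) / 2 + Pot x + γ * (⟪x, v⟫ + k / 2 * ‖x‖ ^ 2)

lemma energy_dissipation
    (hA0 : ∀ x : E, 0 ≤ ⟪A x, x⟫) (hPot0 : ∀ x, 0 ≤ Pot0 x)
    (hF3a : ∃ η c₄ c₅ : ℝ, 0 ≤ η ∧ η < 1 ∧ 0 < c₄ ∧ 0 < c₅ ∧
      ∀ x : E, -⟪x, F x⟫ ≤ η * ⟪A x, x⟫ - c₄ * Pot0 x + c₅)
    (hF3b : ∀ η' > (0:ℝ), ∃ C > (0:ℝ), ∀ x : E, ‖x‖ ^ 2 ≤ C + η' * (⟪A x, x⟫ + Pot0 x))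
    (hF3c : ∃ c₆ c₇ : ℝ, 0 ≤ c₆ ∧ 0 ≤ c₇ ∧ ∀ x : E, ‖Fstar x‖ ^ 2 ≤ c₆ + c₇ * ‖x‖ ^ 2)
    {L : NNReal} (hG : LipschitzWith L G) {k₀ : ℝ} (hk₀ : 0 < k₀) :
    ∃ h₀ > 0, ∃ κ > 0, ∃ K, ∀ k h, k₀ ≤ k → 0 < h → h ≤ h₀ → ∀ (x v m : E) (I : ℝ), 0 ≤ I →
      ‖m - G x‖ ^ 2 ≤ L ^ 2 * (h * I) →
      ⟪v, -(k • v + A x + F x + m)⟫ + ⟪A x, v⟫ + ⟪F x - Fstar x, v⟫ +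
        k₀ / 4 * (⟪v, v⟫ + ⟪x, -(k • v + A x + F x + m)⟫ + k * ⟪x, v⟫) + (h * ‖v‖ ^ 2 - I) ≤
      K - κ * (‖v‖ ^ 2 + (⟪A x, x⟫ + Pot0 x) + I) := by
  obtain ⟨η, c₄, c₅, hη0, hη1, hc₄, hc₅, hF3a⟩ := hF3a
  obtain ⟨c₆, c₇, hc₆, hc₇, hF3c⟩ := hF3c
  set c := min (1 - η) c₄ with hc
  have hc0 : 0 < c := lt_min (by linarith) hc₄
  set γ := k₀ / 4 with hγ
  have hγ0 : 0 < γ := by positivity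
  set b := 2 / k₀ + γ / 2 with hb
  have hb0 : 0 < b := by positivity
  set K₄ := b * (3 * (L : ℝ) ^ 2) with hK₄
  have hK₄0 : 0 ≤ K₄ := by positivity
  set X := 2 / k₀ * c₇ + γ / 2 + K₄ with hX
  have hX0 : 0 < X := by positivity
  obtain ⟨C, hC, hF3b⟩ := hF3b (γ * c / 2 / X) (by positivity)
  set κ := min (k₀ / 4) (min (γ * c / 2) (1 / 2)) with hκ
  have hκ1 : κ ≤ k₀ / 4 := min_le_left _ _
  have hκ2 : κ ≤ γ * c / 2 := (min_le_right _ _).trans (min_le_left _ _)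
  have hκ3 : κ ≤ 1 / 2 := (min_le_right _ _).trans (min_le_right _ _)
  refine ⟨min (k₀ / 4) (1 / (2 * (K₄ + 1))), by positivity, κ, by positivity,
    2 / k₀ * c₆ + γ * c₅ + b * (3 * ‖G 0‖ ^ 2) + X * C, ?_⟩
  intro k h hk hh hh₀ x v m I hI hm
  have hhk : h ≤ k₀ / 4 := hh₀.trans (min_le_left _ _)
  have hhK : h * K₄ ≤ 1 / 2 := by
    have := (le_div_iff₀ (by positivity)).1 (hh₀.trans (min_le_right _ _))
    nlinarith
  have hexp : ⟪v, -(k • v + A x + F x + m)⟫ + ⟪A x, v⟫ + ⟪F x - Fstar x, v⟫ +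
        γ * (⟪v, v⟫ + ⟪x, -(k • v + A x + F x + m)⟫ + k * ⟪x, v⟫) + (h * ‖v‖ ^ 2 - I) =
      -k * ‖v‖ ^ 2 + -⟪v, Fstar x⟫ + -⟪v, m⟫ +
        γ * (‖v‖ ^ 2 - ⟪A x, x⟫ + -⟪x, F x⟫ + -⟪x, m⟫) + (h * ‖v‖ ^ 2 - I) := by
    simp only [inner_neg_right, inner_add_right, inner_sub_left, real_inner_smul_right,
      real_inner_self_eq_norm_sq, real_inner_comm x (A x), real_inner_comm v (A x),
      real_inner_comm v (F x), real_inner_comm v (Fstar x)]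
    ring
  rw [hexp]
  have h1 := neg_inner_le v (Fstar x) hk₀
  have h2 := neg_inner_le v m hk₀
  have h3 : -⟪x, m⟫ ≤ ‖x‖ ^ 2 / 2 + ‖m‖ ^ 2 / 2 := by
    have := neg_inner_le x m (c := 4) (by norm_num)
    linarith
  have h4 := hF3c x
  have h5 : ‖m‖ ^ 2 ≤ 3 * ‖G 0‖ ^ 2 + 3 * (L : ℝ) ^ 2 * ‖x‖ ^ 2 + 3 * (L : ℝ) ^ 2 * (h * I) := by
    have e1 : ‖m‖ ≤ ‖G 0‖ + L * ‖x‖ + ‖m - G x‖ := by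
      have hd := hG.dist_le_mul x 0
      rw [dist_eq_norm, dist_zero_right] at hd
      calc ‖m‖ = ‖G 0 + (G x - G 0) + (m - G x)‖ := by congr 1; abel
        _ ≤ ‖G 0‖ + ‖G x - G 0‖ + ‖m - G x‖ := norm_add₃_le
        _ ≤ _ := by gcongr
    have e2 := sq_le_three_mul_of_le_add (norm_nonneg m) e1
    have e3 : (L * ‖x‖) ^ 2 = (L : ℝ) ^ 2 * ‖x‖ ^ 2 := mul_pow _ _ _
    linarith only [e2, e3, hm]
  have h6 : γ * (-⟪A x, x⟫ + -⟪x, F x⟫) ≤ γ * (c₅ - c * (⟪A x, x⟫ + Pot0 x)) := by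
    refine mul_le_mul_of_nonneg_left ?_ hγ0.le
    have e1 := mul_le_mul_of_nonneg_right (min_le_left (1 - η) c₄) (hA0 x)
    have e2 := mul_le_mul_of_nonneg_right (min_le_right (1 - η) c₄) (hPot0 x)
    linarith [hF3a x]
  have h7 : X * ‖x‖ ^ 2 ≤ X * C + γ * c / 2 * (⟪A x, x⟫ + Pot0 x) := by
    have e1 := mul_le_mul_of_nonneg_left (hF3b x) hX0.le
    have e2 : X * (C + γ * c / 2 / X * (⟪A x, x⟫ + Pot0 x)) =
        X * C + γ * c / 2 * (⟪A x, x⟫ + Pot0 x) := by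
      field_simp
    linarith
  have hy : 0 ≤ ‖v‖ ^ 2 := by positivity
  have haP : 0 ≤ ⟪A x, x⟫ + Pot0 x := add_nonneg (hA0 x) (hPot0 x)
  have h8 := mul_le_mul_of_nonneg_right hhk hy
  have h9 := mul_le_mul_of_nonneg_right hhK hI
  have h10 := mul_le_mul_of_nonneg_right hk hy
  have h11 := mul_le_mul_of_nonneg_right hκ1 hy
  have h12 := mul_le_mul_of_nonneg_right hκ2 haP
  have h13 := mul_le_mul_of_nonneg_right hκ3 hI
  have h14 := mul_le_mul_of_nonneg_left h4 (by positivity : 0 ≤ 2 / k₀)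
  have h15 := mul_le_mul_of_nonneg_left h5 hb0.le
  have h16 := mul_le_mul_of_nonneg_left h3 hγ0.le
  have h17 : b * ‖m‖ ^ 2 = 2 / k₀ * ‖m‖ ^ 2 + γ / 2 * ‖m‖ ^ 2 := by rw [hb]; ring
  have h18 : X * ‖x‖ ^ 2 = 2 / k₀ * c₇ * ‖x‖ ^ 2 + γ / 2 * ‖x‖ ^ 2 + K₄ * ‖x‖ ^ 2 := by
    rw [hX]; ring
  have h19 : b * (3 * ‖G 0‖ ^ 2 + 3 * (L : ℝ) ^ 2 * ‖x‖ ^ 2 + 3 * (L : ℝ) ^ 2 * (h * I)) =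
      b * (3 * ‖G 0‖ ^ 2) + K₄ * ‖x‖ ^ 2 + h * K₄ * I := by rw [hK₄]; ring
  have h20 : γ * ‖v‖ ^ 2 = k₀ / 4 * ‖v‖ ^ 2 := by rw [hγ]
  clear_value b K₄ X κ c γ
  generalize ‖v‖ ^ 2 = y at *
  generalize ‖x‖ ^ 2 = z at *
  generalize ‖m‖ ^ 2 = w at *
  generalize ‖Fstar x‖ ^ 2 = f at *
  generalize ‖G 0‖ ^ 2 = g at *
  generalize (L : ℝ) ^ 2 = l at *
  generalize ⟪A x, x⟫ = a at *
  linarith only [h1, h2, h6, h7, h8, h9, h10, h11, h12, h13, h14, h15, h16, h17, h18, h19, h20]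

lemma perturbedEnergy_le (hA0 : ∀ x : E, 0 ≤ ⟪A x, x⟫)
    (hPot_split : ∀ x, Pot x = Pot0 x + Pot1 x)
    (hPot1_bound : ∀ η > (0:ℝ), ∃ C > (0:ℝ), ∀ x : E,
      |Pot1 x| ≤ η * (⟪A x, x⟫ + Pot0 x) + C)
    (hF3b : ∀ η' > (0:ℝ), ∃ C > (0:ℝ), ∀ x : E, ‖x‖ ^ 2 ≤ C + η' * (⟪A x, x⟫ + Pot0 x))
    {γ k : ℝ} (hγ : 0 ≤ γ) (hk : 0 ≤ k) :
    ∃ Q > 0, ∃ C, ∀ x v : E,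
      perturbedEnergy A Pot γ k x v ≤ Q * (‖v‖ ^ 2 + (⟪A x, x⟫ + Pot0 x)) + C := by
  obtain ⟨C₁, -, h₁⟩ := hPot1_bound 1 one_pos
  obtain ⟨C₂, -, h₂⟩ := hF3b 1 one_pos
  refine ⟨2 + γ + γ * k, by positivity, C₁ + (γ + γ * k) * C₂, fun x v => ?_⟩
  have e1 := (le_abs_self _).trans (h₁ x)
  have e2 : ⟪x, v⟫ ≤ ‖x‖ ^ 2 + ‖v‖ ^ 2 := by
    nlinarith [real_inner_le_norm x v, sq_nonneg (‖x‖ - ‖v‖), sq_nonneg ‖x‖, sq_nonneg ‖v‖]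
  have e3 := mul_le_mul_of_nonneg_left e2 hγ
  have e4 := mul_le_mul_of_nonneg_left (h₂ x) (by positivity : 0 ≤ γ + γ * k)
  have e5 : 0 ≤ γ * k * ‖x‖ ^ 2 := by positivity
  have e6 : 0 ≤ γ * k * ‖v‖ ^ 2 := by positivity
  have e7 : 0 ≤ ‖v‖ ^ 2 := by positivity
  rw [perturbedEnergy, hPot_split]
  linarith [hA0 x]

lemma sq_norm_le_perturbedEnergy (hA0 : ∀ x : E, 0 ≤ ⟪A x, x⟫) (hPot0 : ∀ x, 0 ≤ Pot0 x)
    (hPot_split : ∀ x, Pot x = Pot0 x + Pot1 x)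
    (hPot1_bound : ∀ η > (0:ℝ), ∃ C > (0:ℝ), ∀ x : E,
      |Pot1 x| ≤ η * (⟪A x, x⟫ + Pot0 x) + C)
    (hF3b : ∀ η' > (0:ℝ), ∃ C > (0:ℝ), ∀ x : E, ‖x‖ ^ 2 ≤ C + η' * (⟪A x, x⟫ + Pot0 x))
    {γ k : ℝ} (hγ : 0 ≤ γ) (hk : 4 * γ ≤ k) :
    ∃ C, ∀ x v : E, ‖x‖ ^ 2 ≤ 4 * perturbedEnergy A Pot γ k x v + C ∧
      ‖v‖ ^ 2 ≤ 4 * perturbedEnergy A Pot γ k x v + C := by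
  obtain ⟨C₁, hC₁, h₁⟩ := hPot1_bound (1 / 4) (by norm_num)
  obtain ⟨C₂, hC₂, h₂⟩ := hF3b 1 one_pos
  refine ⟨4 * C₁ + C₂, fun x v => ?_⟩
  have e1 := (neg_le_of_abs_le (h₁ x))
  have e2 : -(γ * ⟪x, v⟫) ≤ ‖v‖ ^ 2 / 4 + γ ^ 2 * ‖x‖ ^ 2 := by
    have := mul_le_mul_of_nonneg_left (neg_le_of_abs_le (abs_real_inner_le_norm x v)) hγ
    nlinarith [sq_nonneg (‖v‖ / 2 - γ * ‖x‖)]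
  have e3 : γ ^ 2 * ‖x‖ ^ 2 ≤ γ * (k / 2 * ‖x‖ ^ 2) := by
    rw [← mul_assoc]
    refine mul_le_mul_of_nonneg_right ?_ (by positivity)
    nlinarith
  have e4 : ‖v‖ ^ 2 / 4 + (⟪A x, x⟫ + Pot0 x) / 4 ≤ perturbedEnergy A Pot γ k x v + C₁ := by
    rw [perturbedEnergy, hPot_split]
    linarith [hA0 x, hPot0 x]
  have e5 := h₂ x
  have e6 : 0 ≤ ‖v‖ ^ 2 := by positivity
  constructor <;> linarith [hA0 x, hPot0 x]

/-- Dissipativity of the damped second order equation with a small delay. -/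
theorem exists_absorbing_ball {n : ℕ} {A : Euc n →L[ℝ] Euc n} {F Fstar G : Euc n → Euc n}
    {Pot Pot0 Pot1 : Euc n → ℝ}
    (hA_symm : ∀ x y : Euc n, ⟪A x, y⟫ = ⟪x, A y⟫) (hA0 : ∀ x : Euc n, 0 ≤ ⟪A x, x⟫)
    (hPot_cont : Continuous Pot) (hF_grad : ∀ x, HasGradientAt Pot (F x - Fstar x) x)
    (hPot_split : ∀ x, Pot x = Pot0 x + Pot1 x) (hPot0 : ∀ x, 0 ≤ Pot0 x)
    (hPot1_bound : ∀ η > (0:ℝ), ∃ C > (0:ℝ), ∀ x : Euc n,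
      |Pot1 x| ≤ η * (⟪A x, x⟫ + Pot0 x) + C)
    (hF3a : ∃ η c₄ c₅ : ℝ, 0 ≤ η ∧ η < 1 ∧ 0 < c₄ ∧ 0 < c₅ ∧
      ∀ x : Euc n, -⟪x, F x⟫ ≤ η * ⟪A x, x⟫ - c₄ * Pot0 x + c₅)
    (hF3b : ∀ η' > (0:ℝ), ∃ C > (0:ℝ), ∀ x : Euc n,
      ‖x‖ ^ 2 ≤ C + η' * (⟪A x, x⟫ + Pot0 x))
    (hF3c : ∃ c₆ c₇ : ℝ, 0 ≤ c₆ ∧ 0 ≤ c₇ ∧ ∀ x : Euc n, ‖Fstar x‖ ^ 2 ≤ c₆ + c₇ * ‖x‖ ^ 2)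
    {L : NNReal} (hG : LipschitzWith L G) {k₀ : ℝ} (hk₀ : 0 < k₀) :
    ∃ h₀ > 0, ∀ k h, k₀ ≤ k → 0 < h → h ≤ h₀ → ∃ R, ∀ r, ∃ R' T₀, ∀ (u v : ℝ → Euc n) (σ : ℝ → ℝ),
      IsC1Curve u v → (∀ t, σ t ∈ Icc 0 h) →
      (∀ t > 0, HasDerivAt v (-(k • v t + A (u t) + F (u t) + G (u (t - σ t)))) t) →
      (∀ t ∈ Icc (-h) 0, ‖u t‖ ≤ r ∧ ‖v t‖ ≤ r) →
      (∀ t, -h ≤ t → ‖u t‖ ≤ R' ∧ ‖v t‖ ≤ R') ∧ ∀ t, T₀ ≤ t → ‖u t‖ ≤ R ∧ ‖v t‖ ≤ R := by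
  obtain ⟨h₀, hh₀, κ, hκ, K, hdiss⟩ :=
    energy_dissipation (Fstar := Fstar) hA0 hPot0 hF3a hF3b hF3c hG hk₀
  refine ⟨h₀, hh₀, fun k h hk hh hhh₀ => ?_⟩
  have hk0 : 0 ≤ k := hk₀.le.trans hk
  set γ := k₀ / 4 with hγ
  have hγ0 : 0 ≤ γ := by positivity
  obtain ⟨Q, hQ, C₁, hup⟩ :=
    perturbedEnergy_le hA0 hPot_split hPot1_bound hF3b hγ0 hk0
  obtain ⟨C₂, hlow⟩ := sq_norm_le_perturbedEnergy hA0 hPot0 hPot_split hPot1_bound hF3b hγ0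
    (by linarith : 4 * γ ≤ k)
  set δ := κ / (Q + h) with hδ
  have hδ0 : 0 < δ := by positivity
  set K' := K + δ * C₁ with hK'
  set R := √(max 0 (4 * (K' / δ + 1) + C₂)) with hR
  refine ⟨R, fun r => ?_⟩
  obtain ⟨B, hB⟩ := (isCompact_closedBall (0 : Euc n) r).exists_bound_of_continuousOn
    hPot_cont.continuousOn
  set Y₀ := (r ^ 2 + ‖A‖ * r ^ 2) / 2 + B + γ * (r ^ 2 + k / 2 * r ^ 2) + h * (h * r ^ 2) with hY₀
  obtain ⟨T₁, hT₁0, hT₁⟩ : ∃ T₁ ≥ 0, ∀ t ≥ T₁, |Y₀ - K' / δ| * rexp (-(δ * t)) ≤ 1 := by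
    refine ⟨|Y₀ - K' / δ| / δ, by positivity, fun t ht => ?_⟩
    rw [Real.exp_neg, ← div_eq_mul_inv, div_le_one (exp_pos _)]
    rw [ge_iff_le, div_le_iff₀' hδ0] at ht
    linarith [add_one_le_exp (δ * t)]
  refine ⟨max r √(max 0 (4 * (K' / δ + |Y₀ - K' / δ|) + C₂)), T₁, ?_⟩
  intro u v σ hu hσ hv hinit
  have hvc : Continuous v := hu.2
  have huc : Continuous u := hu.continuous
  obtain ⟨D, hDd, hDb⟩ := exists_delay_functional (w := fun t => ‖v t‖ ^ 2) (by fun_prop)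
    (fun t => sq_nonneg _) hh.le
  set V : ℝ → ℝ := fun t => perturbedEnergy A Pot γ k (u t) (v t) with hV
  have hVc : Continuous V := by
    simp only [hV, perturbedEnergy]
    fun_prop
  have hDc : Continuous D := continuous_iff_continuousAt.2 fun t => (hDd t).continuousAt
  have hI0 : ∀ t, 0 ≤ ∫ s in (t - h)..t, ‖v s‖ ^ 2 := fun t =>
    intervalIntegral.integral_nonneg (by linarith) fun s _ => sq_nonneg _
  have hVd : ∀ t > 0, HasDerivAt V
      (⟪v t, -(k • v t + A (u t) + F (u t) + G (u (t - σ t)))⟫ + ⟪A (u t), v t⟫ +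
        ⟪F (u t) - Fstar (u t), v t⟫ + γ * (⟪v t, v t⟫ +
          ⟪u t, -(k • v t + A (u t) + F (u t) + G (u (t - σ t)))⟫ + k * ⟪u t, v t⟫)) t := by
    intro t ht
    have du := hu.1 t
    have dA : HasDerivAt (fun t => A (u t)) (A (v t)) t := A.hasFDerivAt.comp_hasDerivAt t du
    have dP : HasDerivAt (fun t => Pot (u t)) ⟪F (u t) - Fstar (u t), v t⟫ t :=
      ((hF_grad (u t)).hasFDerivAt.comp_hasDerivAt t du).congr_deriv (by simp [inner_sub_left])
    refine ((((hv t ht).norm_sq.add (dA.inner ℝ du)).div_const 2).add dP |>.add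
      (((du.inner ℝ (hv t ht)).add (du.norm_sq.const_mul (k / 2))).const_mul γ)).congr_deriv ?_
    rw [hA_symm (v t), real_inner_comm (A (u t)) (v t)]
    ring
  have hdec : ∀ t ≥ 0, V t + D t ≤ K' / δ + (V 0 + D 0 - K' / δ) * rexp (-(δ * t)) := by
    refine le_of_deriv_le_sub_mul hδ0 (hVc.add hDc).continuousOn
      (fun t ht => (hVd t ht).add (hDd t)) fun t ht => ?_
    have hm : ‖G (u (t - σ t)) - G (u t)‖ ^ 2 ≤
        (L : ℝ) ^ 2 * (h * ∫ s in (t - h)..t, ‖v s‖ ^ 2) := by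
      have e1 := hG.dist_le_mul (u (t - σ t)) (u t)
      rw [dist_eq_norm, dist_eq_norm] at e1
      refine (pow_le_pow_left₀ (norm_nonneg _) e1 2).trans ?_
      rw [mul_pow]
      exact mul_le_mul_of_nonneg_left (hu.norm_sub_sq_le hh (hσ t) t) (by positivity)
    have e1 := hdiss k h hk hh hhh₀ (u t) (v t) _ _ (hI0 t) hm
    refine e1.trans ?_
    have e2 : V t + D t ≤
        (Q + h) * (‖v t‖ ^ 2 + (⟪A (u t), u t⟫ + Pot0 (u t)) + ∫ s in (t - h)..t, ‖v s‖ ^ 2) +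
          C₁ := by
      have e3 := hup (u t) (v t)
      have e4 := (hDb t).2
      have e5 := mul_nonneg hQ.le (hI0 t)
      have e6 : 0 ≤ h * (‖v t‖ ^ 2 + (⟪A (u t), u t⟫ + Pot0 (u t))) :=
        mul_nonneg hh.le (add_nonneg (sq_nonneg _) (add_nonneg (hA0 _) (hPot0 _)))
      simp only [hV]
      linarith
    have e7 := mul_le_mul_of_nonneg_left e2 hδ0.le
    have e8 : δ * (Q + h) = κ := div_mul_cancel₀ _ (by positivity)
    have e9 : ∀ S, δ * ((Q + h) * S + C₁) = κ * S + δ * C₁ := fun S => by rw [← e8]; ring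
    rw [e9] at e7
    linarith
  have hinit0 : V 0 + D 0 ≤ Y₀ := by
    obtain ⟨hu0, hv0⟩ := hinit 0 ⟨by linarith, le_rfl⟩
    have hu2 := pow_le_pow_left₀ (norm_nonneg _) hu0 2
    have hv2 := pow_le_pow_left₀ (norm_nonneg _) hv0 2
    have e1 : ⟪A (u 0), u 0⟫ ≤ ‖A‖ * r ^ 2 :=
      calc ⟪A (u 0), u 0⟫ ≤ ‖A (u 0)‖ * ‖u 0‖ := real_inner_le_norm _ _
        _ ≤ ‖A‖ * ‖u 0‖ * ‖u 0‖ := by gcongr; exact A.le_opNorm _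
        _ = ‖A‖ * ‖u 0‖ ^ 2 := by ring
        _ ≤ _ := by gcongr
    have e2 : Pot (u 0) ≤ B :=
      (le_abs_self _).trans (hB (u 0) (mem_closedBall_zero_iff.2 hu0))
    have e3 : ⟪u 0, v 0⟫ ≤ r ^ 2 :=
      calc ⟪u 0, v 0⟫ ≤ ‖u 0‖ * ‖v 0‖ := real_inner_le_norm _ _
        _ ≤ r * r := by gcongr; exact (norm_nonneg _).trans hu0
        _ = r ^ 2 := (sq r).symm
    have e4 : ∫ s in (0 - h)..0, ‖v s‖ ^ 2 ≤ h * r ^ 2 := by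
      have := intervalIntegral.integral_mono_on (μ := volume) (f := fun s => ‖v s‖ ^ 2)
        (g := fun _ => r ^ 2) (by linarith : 0 - h ≤ 0)
        ((by fun_prop : Continuous fun s => ‖v s‖ ^ 2).intervalIntegrable _ _) (by simp)
        fun s hs => pow_le_pow_left₀ (norm_nonneg _)
          (hinit s ⟨by linarith [hs.1], hs.2⟩).2 2
      simpa using this
    have e5 : ⟪u 0, v 0⟫ + k / 2 * ‖u 0‖ ^ 2 ≤ r ^ 2 + k / 2 * r ^ 2 := by gcongr
    have e6 := mul_le_mul_of_nonneg_left e5 hγ0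
    have e7 := (hDb 0).2.trans (mul_le_mul_of_nonneg_left e4 hh.le)
    simp only [hV, perturbedEnergy, hY₀]
    linarith
  have hbound : ∀ t ≥ 0, ∀ c, |Y₀ - K' / δ| * rexp (-(δ * t)) ≤ c →
      ‖u t‖ ≤ √(max 0 (4 * (K' / δ + c) + C₂)) ∧ ‖v t‖ ≤ √(max 0 (4 * (K' / δ + c) + C₂)) := by
    intro t ht c hc
    have e1 := hdec t ht
    have e2 : (V 0 + D 0 - K' / δ) * rexp (-(δ * t)) ≤ c :=
      (mul_le_mul_of_nonneg_right ((sub_le_sub_right hinit0 _).trans (le_abs_self _))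
        (exp_pos _).le).trans hc
    have e3 := (hDb t).1
    have e4 := hlow (u t) (v t)
    have e5 : 4 * V t + C₂ ≤ 4 * (K' / δ + c) + C₂ := by linarith
    exact ⟨Real.le_sqrt_of_sq_le ((e4.1.trans e5).trans (le_max_right _ _)),
      Real.le_sqrt_of_sq_le ((e4.2.trans e5).trans (le_max_right _ _))⟩
  refine ⟨fun t ht => ?_, fun t ht => hbound t (hT₁0.trans ht) 1 (hT₁ t ht)⟩
  rcases le_or_gt t 0 with h0 | h0
  · exact ⟨(hinit t ⟨ht, h0⟩).1.trans (le_max_left _ _),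
      (hinit t ⟨ht, h0⟩).2.trans (le_max_left _ _)⟩
  · have := hbound t h0.le _ (mul_le_of_le_one_right (abs_nonneg (Y₀ - K' / δ))
      (Real.exp_le_one_iff.2 (by nlinarith)))
    exact ⟨this.1.trans (le_max_right _ _), this.2.trans (le_max_right _ _)⟩

end Energy

/-! ### The equation with a state-dependent delay -/

section StateDependentDelay

variable {n : ℕ} {h k : ℝ} {A : Euc n →L[ℝ] Euc n} {F G : Euc n → Euc n}
  {τ : (ℝ → Euc n) → (ℝ → Euc n) → ℝ}

lemma Wnorm_le (hh : 0 ≤ h) {φ φ' : ℝ → Euc n} {a : ℝ}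
    (ha : ∀ θ ∈ Icc (-h) (0:ℝ), ‖φ θ‖ ≤ a ∧ ‖φ' θ‖ ≤ a) : Wnorm n h φ φ' ≤ a + a := by
  have : Nonempty (Icc (-h) (0:ℝ)) := ⟨⟨0, by simpa using hh, le_rfl⟩⟩
  exact add_le_add (ciSup_le fun θ => (ha θ θ.2).1) (ciSup_le fun θ => (ha θ θ.2).2)

/-- The right-hand side `k u' + A u + F(u) + G(u(t - τ(u_t)))`. -/
def stateDelayField (k : ℝ) (A : Euc n →L[ℝ] Euc n) (F G : Euc n → Euc n)
    (τ : (ℝ → Euc n) → (ℝ → Euc n) → ℝ) (u v : ℝ → Euc n) (s : ℝ) : Euc n :=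
  k • v s + A (u s) + F (u s) + G (u (s + -(τ (fun θ => u (s + θ)) (fun θ => v (s + θ)))))

lemma isDelayField_stateDelayField (hh : 0 ≤ h) (hF : LocallyLipschitz F) {L : NNReal}
    (hG : LipschitzWith L G)
    (hτ : ∀ φ φ' : ℝ → Euc n, IsC1Pair n h φ φ' → τ φ φ' ∈ Icc (0:ℝ) h)
    (hτL : ∀ ρ > (0:ℝ), ∃ C > (0:ℝ), ∀ φ₁ φ₁' φ₂ φ₂' : ℝ → Euc n,
      IsC1Pair n h φ₁ φ₁' → IsC1Pair n h φ₂ φ₂' →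
      Wnorm n h φ₁ φ₁' ≤ ρ → Wnorm n h φ₂ φ₂' ≤ ρ →
      |τ φ₁ φ₁' - τ φ₂ φ₂'| ≤ C * Wnorm n h (φ₁ - φ₂) (φ₁' - φ₂')) :
    IsDelayField h (stateDelayField k A F G τ) := by
  refine ⟨fun u v c s => ?_, fun R hR => ?_⟩
  · simp only [stateDelayField, add_right_comm s _ c]
  obtain ⟨KF, hKF⟩ := (hF.locallyLipschitzOn (s := Metric.closedBall 0 R)
    ).exists_lipschitzOnWith_of_compact (isCompact_closedBall 0 R)
  obtain ⟨C, hC, hCτ⟩ := hτL (R + R) (by positivity)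
  refine ⟨|k| + ‖A‖ + KF + L * (R * (C * 2) + 1), by positivity, ?_⟩
  intro u₁ v₁ u₂ v₂ s m h₁ h₂ hb hm
  have hmem : ∀ θ ∈ Icc (-h) 0, s + θ ∈ Icc (s - h) s := fun θ hθ =>
    ⟨by linarith [hθ.1], by linarith [hθ.2]⟩
  have hs : s ∈ Icc (s - h) s := ⟨by linarith, le_rfl⟩
  set τ₁ := τ (fun θ => u₁ (s + θ)) (fun θ => v₁ (s + θ))
  set τ₂ := τ (fun θ => u₂ (s + θ)) (fun θ => v₂ (s + θ))
  have hτ₁ : τ₁ ∈ Icc 0 h := hτ _ _ (h₁.isC1Pair s)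
  have hτ₂ : τ₂ ∈ Icc 0 h := hτ _ _ (h₂.isC1Pair s)
  have hr₁ : s + -τ₁ ∈ Icc (s - h) s := ⟨by linarith [hτ₁.2], by linarith [hτ₁.1]⟩
  have hr₂ : s + -τ₂ ∈ Icc (s - h) s := ⟨by linarith [hτ₂.2], by linarith [hτ₂.1]⟩
  have eτ : |τ₁ - τ₂| ≤ C * (m + m) := by
    refine (hCτ _ _ _ _ (h₁.isC1Pair s) (h₂.isC1Pair s)
      (Wnorm_le hh fun θ hθ => ⟨(hb _ (hmem θ hθ)).1, (hb _ (hmem θ hθ)).2.1⟩)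
      (Wnorm_le hh fun θ hθ => (hb _ (hmem θ hθ)).2.2)).trans ?_
    exact mul_le_mul_of_nonneg_left (Wnorm_le hh fun θ hθ => hm _ (hmem θ hθ)) hC.le
  have eu : ‖u₁ (s + -τ₁) - u₂ (s + -τ₂)‖ ≤ R * (C * (m + m)) + m := by
    have e1 : ‖u₁ (s + -τ₁) - u₁ (s + -τ₂)‖ ≤ R * (C * (m + m)) := by
      refine (h₁.norm_sub_le fun r hr => (hb r (uIcc_subset_Icc hr₂ hr₁ hr)).2.1).trans ?_
      refine mul_le_mul_of_nonneg_left (le_of_eq_of_le ?_ eτ) hR.le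
      rw [abs_sub_comm]
      congr 1
      ring
    calc _ = ‖(u₁ (s + -τ₁) - u₁ (s + -τ₂)) + (u₁ (s + -τ₂) - u₂ (s + -τ₂))‖ := by
          rw [sub_add_sub_cancel]
      _ ≤ _ := (norm_add_le _ _).trans (add_le_add e1 (hm _ hr₂).1)
  have eG : ‖G (u₁ (s + -τ₁)) - G (u₂ (s + -τ₂))‖ ≤ L * (R * (C * (m + m)) + m) := by
    rw [← dist_eq_norm]
    refine (hG.dist_le_mul _ _).trans ?_
    rw [dist_eq_norm]
    gcongr
  have eF : ‖F (u₁ s) - F (u₂ s)‖ ≤ KF * m := by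
    rw [← dist_eq_norm]
    refine (hKF.dist_le_mul _ (mem_closedBall_zero_iff.2 (hb s hs).1) _
      (mem_closedBall_zero_iff.2 (hb s hs).2.2.1)).trans ?_
    rw [dist_eq_norm]
    exact mul_le_mul_of_nonneg_left (hm s hs).1 KF.2
  have eA : ‖A (u₁ s) - A (u₂ s)‖ ≤ ‖A‖ * m := by
    rw [← map_sub]
    exact (A.le_opNorm _).trans (mul_le_mul_of_nonneg_left (hm s hs).1 (norm_nonneg _))
  have ek : ‖k • v₁ s - k • v₂ s‖ ≤ |k| * m := by
    rw [← smul_sub, norm_smul, Real.norm_eq_abs]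
    exact mul_le_mul_of_nonneg_left (hm s hs).2 (abs_nonneg _)
  have key : stateDelayField k A F G τ u₁ v₁ s - stateDelayField k A F G τ u₂ v₂ s =
      (k • v₁ s - k • v₂ s) + (A (u₁ s) - A (u₂ s)) + (F (u₁ s) - F (u₂ s)) +
        (G (u₁ (s + -τ₁)) - G (u₂ (s + -τ₂))) := by
    simp only [stateDelayField, τ₁, τ₂]
    abel
  rw [key]
  have := norm_add₃_le (a := k • v₁ s - k • v₂ s) (b := A (u₁ s) - A (u₂ s))
    (c := F (u₁ s) - F (u₂ s))
  have := norm_add_le ((k • v₁ s - k • v₂ s) + (A (u₁ s) - A (u₂ s)) + (F (u₁ s) - F (u₂ s)))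
    (G (u₁ (s + -τ₁)) - G (u₂ (s + -τ₂)))
  linarith

lemma delay_congr
    (hτL : ∀ ρ > (0:ℝ), ∃ C > (0:ℝ), ∀ φ₁ φ₁' φ₂ φ₂' : ℝ → Euc n,
      IsC1Pair n h φ₁ φ₁' → IsC1Pair n h φ₂ φ₂' →
      Wnorm n h φ₁ φ₁' ≤ ρ → Wnorm n h φ₂ φ₂' ≤ ρ →
      |τ φ₁ φ₁' - τ φ₂ φ₂'| ≤ C * Wnorm n h (φ₁ - φ₂) (φ₁' - φ₂'))
    (hh : 0 ≤ h) {φ φ' ψ ψ' : ℝ → Euc n} (hφ : IsC1Pair n h φ φ')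
    (heq : ∀ θ ∈ Icc (-h) (0:ℝ), ψ θ = φ θ ∧ ψ' θ = φ' θ) : τ ψ ψ' = τ φ φ' := by
  obtain ⟨C, hC, hCτ⟩ := hτL (1 + (|Wnorm n h φ φ'| + |Wnorm n h ψ ψ'|)) (by positivity)
  have e1 := hCτ ψ ψ' φ φ' (hφ.congr heq) hφ
    (by linarith [le_abs_self (Wnorm n h ψ ψ'), abs_nonneg (Wnorm n h φ φ')])
    (by linarith [le_abs_self (Wnorm n h φ φ'), abs_nonneg (Wnorm n h ψ ψ')])
  have e2 : Wnorm n h (ψ - φ) (ψ' - φ') ≤ 0 + 0 := Wnorm_le hh fun θ hθ => by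
    simp [heq θ hθ]
  rw [add_zero] at e2
  exact sub_eq_zero.1 (abs_nonpos_iff.1 (e1.trans (mul_nonpos_of_nonneg_of_nonpos hC.le e2)))

lemma IsGlobalMildSol.exists_isTraj (hh : 0 ≤ h)
    (hτ : ∀ φ φ' : ℝ → Euc n, IsC1Pair n h φ φ' → τ φ φ' ∈ Icc (0:ℝ) h)
    (hτL : ∀ ρ > (0:ℝ), ∃ C > (0:ℝ), ∀ φ₁ φ₁' φ₂ φ₂' : ℝ → Euc n,
      IsC1Pair n h φ₁ φ₁' → IsC1Pair n h φ₂ φ₂' →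
      Wnorm n h φ₁ φ₁' ≤ ρ → Wnorm n h φ₂ φ₂' ≤ ρ →
      |τ φ₁ φ₁' - τ φ₂ φ₂'| ≤ C * Wnorm n h (φ₁ - φ₂) (φ₁' - φ₂'))
    (hN : IsDelayField h (stateDelayField k A F G τ)) {φ φ' u u' : ℝ → Euc n}
    (hu : IsGlobalMildSol n h k A F (fun ψ ψ' => G (ψ (-(τ ψ ψ')))) φ φ' u u') :
    ∃ w z, IsTraj (stateDelayField k A F G τ) 0 w z ∧ ∀ t, -h ≤ t → u t = w t ∧ u' t = z t := by
  obtain ⟨hd, hc, h0, hInt⟩ := hu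
  obtain ⟨w, hw, heq⟩ := exists_isC1Curve_extension hd hc
  set z : ℝ → Euc n := fun t => u' (max (-h) t)
  have heq' : ∀ t, -h ≤ t → u t = w t ∧ u' t = z t := fun t ht =>
    ⟨(heq t ht).symm, by simp only [z, max_eq_right ht]⟩
  have hfield : ∀ r, 0 ≤ r → k • u' r + A (u r) + F (u r) +
      G (u (r + -(τ (fun θ => u (r + θ)) (fun θ => u' (r + θ))))) =
      stateDelayField k A F G τ w z r := by
    intro r hr
    have eτ := delay_congr (ψ := fun θ => u (r + θ)) (ψ' := fun θ => u' (r + θ)) hτL hh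
      (hw.isC1Pair r) fun θ hθ => heq' (r + θ) (by linarith [hθ.1])
    have hmem := hτ _ _ (hw.isC1Pair (n := n) (h := h) r)
    rw [eτ, stateDelayField, (heq' r (by linarith)).1, (heq' r (by linarith)).2,
      (heq' (r + -_) (by linarith [hmem.2])).1]
  have hz : ∀ t, 0 ≤ t → z t = φ' 0 - ∫ s in (0:ℝ)..t, stateDelayField k A F G τ w z s := by
    intro t ht
    rw [← (heq' t (by linarith)).2, hInt t ht]
    congr 1
    refine intervalIntegral.integral_congr fun r hr => ?_
    rw [uIcc_of_le ht] at hr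
    exact hfield r hr.1
  refine ⟨w, z, ⟨hw, fun s t hs hst => ?_⟩, heq'⟩
  have hNc := hN.continuous hw
  rw [hz s hs, hz t (hs.trans hst), sub_sub, intervalIntegral.integral_add_adjacent_intervals
    (hNc.intervalIntegrable _ _) (hNc.intervalIntegrable _ _)]

lemma IsTraj.hasDerivAt {N : (ℝ → Euc n) → (ℝ → Euc n) → ℝ → Euc n} (hN : IsDelayField h N)
    {u v : ℝ → Euc n} (hu : IsTraj N 0 u v) {t : ℝ} (ht : 0 < t) :
    HasDerivAt v (-(N u v t)) t := by
  have hNc := hN.continuous hu.1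
  have := (intervalIntegral.integral_hasDerivAt_right (hNc.intervalIntegrable 0 t)
    (hNc.stronglyMeasurableAtFilter _ _) hNc.continuousAt).const_sub (v 0)
  refine this.congr_of_eventuallyEq ?_
  filter_upwards [Ioi_mem_nhds ht] with s hs using hu.2 0 s le_rfl (le_of_lt hs)

end StateDependentDelay

/-- existence of a compact global attractor for the dynamical system
generated by the delay equation with `M(φ) = G(φ(-τ(φ)))`, for any `k ≥ k₀` and
delay time `h ∈ (0,h₀]`. -/
theorem compact_global_attractor
    (n : ℕ) (hn : 1 ≤ n)
    (A : Euc n →L[ℝ] Euc n)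
    (hA_symm : ∀ x y : Euc n, ⟪A x, y⟫ = ⟪x, A y⟫)
    (hA_pos : ∀ x : Euc n, x ≠ 0 → 0 < ⟪A x, x⟫)
    (F : Euc n → Euc n) (hF1 : LocallyLipschitz F)
    -- Hypothesis (F2)
    (Pot Pot0 Pot1 : Euc n → ℝ) (Fstar : Euc n → Euc n)
    (hPot_smooth : ContDiff ℝ 1 Pot)
    (hF_grad : ∀ x : Euc n, HasGradientAt Pot (F x - Fstar x) x)
    (L_Fstar : NNReal) (hFstar_lip : LipschitzWith L_Fstar Fstar)
    (hPot_split : ∀ x, Pot x = Pot0 x + Pot1 x)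
    (hPot0_nonneg : ∀ x, 0 ≤ Pot0 x)
    (hPot1_bound : ∀ η > (0:ℝ), ∃ C > (0:ℝ), ∀ x : Euc n,
      |Pot1 x| ≤ η * (⟪A x, x⟫ + Pot0 x) + C)
    -- Hypothesis (F3)
    (hF3a : ∃ η c₄ c₅ : ℝ, 0 ≤ η ∧ η < 1 ∧ 0 < c₄ ∧ 0 < c₅ ∧
      ∀ x : Euc n, -⟪x, F x⟫ ≤ η * ⟪A x, x⟫ - c₄ * Pot0 x + c₅)
    (hF3b : ∀ η' > (0:ℝ), ∃ C > (0:ℝ), ∀ x : Euc n, ‖x‖^2 ≤ C + η' * (⟪A x, x⟫ + Pot0 x))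
    (hF3c : ∃ c₆ c₇ : ℝ, 0 ≤ c₆ ∧ 0 ≤ c₇ ∧ ∀ x : Euc n, ‖Fstar x‖^2 ≤ c₆ + c₇ * ‖x‖^2)
    -- Hypothesis (M3): `M(φ) = G(φ(-τ(φ)))` with `G` globally Lipschitz
    (G : Euc n → Euc n) (L_G : NNReal) (hG_lip : LipschitzWith L_G G)
    :
    ∀ k₀ > (0:ℝ), ∃ h₀ > (0:ℝ), ∀ k : ℝ, k₀ ≤ k → ∀ h : ℝ, 0 < h → h ≤ h₀ →
      ∀ τ : (ℝ → Euc n) → (ℝ → Euc n) → ℝ,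
        (∀ φ φ' : ℝ → Euc n, IsC1Pair n h φ φ' → τ φ φ' ∈ Icc (0:ℝ) h) →
        (∀ ρ > (0:ℝ), ∃ C > (0:ℝ), ∀ φ₁ φ₁' φ₂ φ₂' : ℝ → Euc n,
          IsC1Pair n h φ₁ φ₁' → IsC1Pair n h φ₂ φ₂' →
          Wnorm n h φ₁ φ₁' ≤ ρ → Wnorm n h φ₂ φ₂' ≤ ρ →
          |τ φ₁ φ₁' - τ φ₂ φ₂'| ≤ C * Wnorm n h (φ₁ - φ₂) (φ₁' - φ₂')) →
        ∃ 𝔄 : Set (Wc n h),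
          IsCompact 𝔄 ∧ (∀ p ∈ 𝔄, InW n h p) ∧
          -- (i) strict invariance: `S_t 𝔄 = 𝔄` for all `t ≥ 0`
          (∀ p ∈ 𝔄, ∀ t ≥ (0:ℝ),
            (∀ u u' : ℝ → Euc n,
              IsGlobalMildSol n h k A F (fun ψ ψ' => G (ψ (-(τ ψ ψ'))))
                (extIcc n h p.1) (extIcc n h p.2) u u' →
              ∃ q ∈ 𝔄, IsSegAt n h u u' t q) ∧
            (∃ q ∈ 𝔄, ∀ u u' : ℝ → Euc n,
              IsGlobalMildSol n h k A F (fun ψ ψ' => G (ψ (-(τ ψ ψ'))))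
                (extIcc n h q.1) (extIcc n h q.2) u u' →
              IsSegAt n h u u' t p)) ∧
          -- (ii) uniform attraction of bounded sets
          (∀ B : Set (Wc n h), Bornology.IsBounded B → (∀ p ∈ B, InW n h p) →
            ∀ ε > (0:ℝ), ∃ T ≥ (0:ℝ), ∀ p ∈ B, ∀ t ≥ T, ∀ u u' : ℝ → Euc n,
              IsGlobalMildSol n h k A F (fun ψ ψ' => G (ψ (-(τ ψ ψ'))))
                (extIcc n h p.1) (extIcc n h p.2) u u' →
              ∃ q ∈ 𝔄, segWdist n h u u' t q ≤ ε) := by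
  intro k₀ hk₀
  have hA0 : ∀ x : Euc n, 0 ≤ ⟪A x, x⟫ := fun x => by
    rcases eq_or_ne x 0 with rfl | hx
    · simp
    · exact (hA_pos x hx).le
  obtain ⟨h₀, hh₀, habs⟩ := exists_absorbing_ball hA_symm hA0 hPot_smooth.continuous hF_grad
    hPot_split hPot0_nonneg hPot1_bound hF3a hF3b hF3c hG_lip hk₀
  refine ⟨h₀, hh₀, fun k hk h hh hhh₀ τ hτ hτL => ?_⟩
  have hN := isDelayField_stateDelayField (k := k) (A := A) hh.le hF1 hG_lip hτ hτL
  obtain ⟨R, hR⟩ := habs k h hk hh hhh₀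
  obtain ⟨𝔄, hcomp, hW, hinv, hatt⟩ := hN.exists_attractor hh.le (R := R) fun r => by
    obtain ⟨R', T₀, hr⟩ := hR r
    refine ⟨R', T₀, fun u v hu hinit => hr u v
      (fun t => τ (fun θ => u (t + θ)) (fun θ => v (t + θ))) hu.1
      (fun t => hτ _ _ (hu.1.isC1Pair t)) (fun t ht => ?_) hinit⟩
    simpa only [stateDelayField, ← sub_eq_add_neg] using hu.hasDerivAt hN ht
  have hseg : ∀ {u u' w z : ℝ → Euc n}, (∀ t, -h ≤ t → u t = w t ∧ u' t = z t) →
      ∀ t ≥ 0, ∀ q : Wc n h, IsSegAt n h u u' t q ↔ IsSegAt n h w z t q := by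
    intro u u' w z heq t ht q
    refine forall_congr' fun θ => ?_
    rw [(heq (t + θ) (by linarith [θ.2.1])).1, (heq (t + θ) (by linarith [θ.2.1])).2]
  have htraj : ∀ {p : Wc n h} {u u' : ℝ → Euc n},
      IsGlobalMildSol n h k A F (fun ψ ψ' => G (ψ (-(τ ψ ψ'))))
        (extIcc n h p.1) (extIcc n h p.2) u u' →
      ∃ w z, IsTraj (stateDelayField k A F G τ) 0 w z ∧ IsSegAt n h w z 0 p ∧
        ∀ t, -h ≤ t → u t = w t ∧ u' t = z t := by
    intro p u u' hu
    obtain ⟨w, z, hw, heq⟩ := hu.exists_isTraj hh.le hτ hτL hN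
    refine ⟨w, z, hw, (hseg heq 0 le_rfl p).1 fun θ => ?_, heq⟩
    rw [zero_add, (hu.2.2.1 θ θ.2).1, (hu.2.2.1 θ θ.2).2, extIcc_apply θ.2, extIcc_apply θ.2]
    exact ⟨rfl, rfl⟩
  refine ⟨𝔄, hcomp, hW, fun p hp t ht => ⟨fun u u' hu => ?_, ?_⟩, fun B hB _ ε hε => ?_⟩
  · obtain ⟨w, z, hw, hp0, heq⟩ := htraj hu
    obtain ⟨q, hq, hqs⟩ := (hinv p hp t ht).1 w z hw hp0
    exact ⟨q, hq, (hseg heq t ht q).2 hqs⟩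
  · obtain ⟨q, hq, hqp⟩ := (hinv p hp t ht).2
    refine ⟨q, hq, fun u u' hu => ?_⟩
    obtain ⟨w, z, hw, hq0, heq⟩ := htraj hu
    exact (hseg heq t ht p).2 (hqp w z hw hq0)
  · obtain ⟨T, hT, hTB⟩ := hatt B hB ε hε
    refine ⟨T, hT, fun p hp t ht u u' hu => ?_⟩
    obtain ⟨w, z, hw, hp0, heq⟩ := htraj hu
    obtain ⟨q, hq, hqd⟩ := hTB p hp t ht w z hw hp0
    refine ⟨q, hq, le_of_eq_of_le ?_ hqd⟩
    have heqt : ∀ θ : Icc (-h) (0:ℝ), u (t + θ) = w (t + θ) ∧ u' (t + θ) = z (t + θ) :=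
      fun θ => heq _ (by linarith [θ.2.1])
    simp only [segWdist, fun θ => (heqt θ).1, fun θ => (heqt θ).2]
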